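/- Fix (z,w) ∈ Λ with representative sequence (z_i,w_i)_{i∈ℕ}, and suppose that for each a ∈ {0,…,b−1} the digit frequency p_a(z,w) := lim_{n→∞} #{1 ≤ i ≤ n : w_i = a}/n exists, with p_0(z,w) ≠ 1 and p_{b−1}(z,w) ≠ 1 (the sequences λ(n)/n and ξ(n)/n are not assumed to converge). Then dim_H Λ_{λ,ξ}(z,w) = limsup_{n→∞} min{ γ/(1 + λ(n)/n), (γ + ((ξ(n)−λ(n))/n)·γ(z,w)₂)/(1 + ξ(n)/n) }, where γ = log #J / log b and γ(z,w)₂ = (Σ_{a=0}^{b−1} p_a(z,w)·log #J₂(a)) / log b. -/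

import Mathlib

open Set Filter Topology MeasureTheory
open scoped ENNReal NNReal Topology

noncomputable section

namespace ShrinkingRect

/-- The real number with 1-indexed base-`b` digit sequence `u` (digit `i` is `u i` for `i ≥ 1`). -/
def val (b : ℕ) (u : ℕ → ℕ) : ℝ := ∑' i : ℕ, (u (i + 1) : ℝ) / (b : ℝ) ^ (i + 1)

/-- The self-similar carpet `Λ` with digit set `J ⊆ {0,…,b−1}²`. -/
def carpet (b : ℕ) (J : Finset (ℕ × ℕ)) : Set (ℝ × ℝ) :=
  {p | ∃ d : ℕ → ℕ × ℕ, (∀ i, 1 ≤ i → d i ∈ J) ∧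
    p = (val b (fun i => (d i).1), val b (fun i => (d i).2))}

/-- `J₂(a)`: the digits of `J` lying in row `a`. -/
def J2 (J : Finset (ℕ × ℕ)) (a : ℕ) : Finset (ℕ × ℕ) := J.filter fun p => p.2 = a

/-- The contraction `f_{u,v}(x,y) = ((x+u)/b, (y+v)/b)`. -/
def fmap (b : ℕ) (uv : ℕ × ℕ) (p : ℝ × ℝ) : ℝ × ℝ :=
  ((p.1 + (uv.1 : ℝ)) / b, (p.2 + (uv.2 : ℝ)) / b)

/-- `f_t = f_{u₁,v₁} ∘ ⋯ ∘ f_{uₙ,vₙ}` for a finite word `t = ((u₁,v₁),…,(uₙ,vₙ))`. -/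
def fword (b : ℕ) (t : List (ℕ × ℕ)) (p : ℝ × ℝ) : ℝ × ℝ :=
  t.foldr (fmap b) p

/-- The limsup set `W_{λ,ξ}(z,w)`. -/
def Wset (b : ℕ) (J : Finset (ℕ × ℕ)) (lam xi : ℕ → ℕ) (z w : ℝ) : Set (ℝ × ℝ) :=
  {p | p ∈ carpet b J ∧
    {t : List (ℕ × ℕ) | t ≠ [] ∧ (∀ e ∈ t, e ∈ J) ∧
      |p.1 - (fword b t (z, w)).1| ≤ (b : ℝ) ^ (-(lam t.length : ℤ) - (t.length : ℤ)) ∧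
      |p.2 - (fword b t (z, w)).2| ≤ (b : ℝ) ^ (-(xi t.length : ℤ) - (t.length : ℤ))}.Infinite}

/-- The closeness condition (in one coordinate) defining `M_n(z,w)`:
`xd` is the digit string of the point, `zd` that of the centre, `L` is `λ(n)` or `ξ(n)`. -/
def closeCond (b L n : ℕ) (zd xd : ℕ → ℕ) : Prop :=
  (∀ i, 1 ≤ i → i < L → xd (i + n) = zd i) ∨
  (∃ j, 1 ≤ j ∧ j < L ∧ (∀ i, 1 ≤ i → i ≤ j - 1 → xd (i + n) = zd i) ∧
    (((xd (j + n) : ℤ) - (zd j : ℤ) = -1 ∧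
        ∀ i, j + 1 ≤ i → i < L → (xd (i + n) : ℤ) - (zd i : ℤ) = (b : ℤ) - 1) ∨
     ((xd (j + n) : ℤ) - (zd j : ℤ) = 1 ∧
        ∀ i, j + 1 ≤ i → i < L → (zd i : ℤ) - (xd (i + n) : ℤ) = (b : ℤ) - 1)))

/-- A choice of representative digit sequences for the points of the carpet: each point of `Λ`
gets a digit sequence in `J` representing it, whose partial products of row cardinalities
`∏ #J₂(y_i)` are eventually maximal among all representations of that point. -/
structure RepMap (b : ℕ) (J : Finset (ℕ × ℕ)) where
  rep : ℝ × ℝ → ℕ → ℕ × ℕ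
  mem_J : ∀ p ∈ carpet b J, ∀ i, 1 ≤ i → rep p i ∈ J
  eq_val : ∀ p ∈ carpet b J,
    p = (val b (fun i => (rep p i).1), val b (fun i => (rep p i).2))
  maximal : ∀ p ∈ carpet b J, ∀ d : ℕ → ℕ × ℕ, (∀ i, 1 ≤ i → d i ∈ J) →
    p = (val b (fun i => (d i).1), val b (fun i => (d i).2)) →
    ∃ N₀ : ℕ, ∀ N, N₀ ≤ N →
      ∏ i ∈ Finset.Icc 1 N, (J2 J (d i).2).card ≤
        ∏ i ∈ Finset.Icc 1 N, (J2 J (rep p i).2).card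

/-- The expanding map `T(x,y) = (bx − x₁, by − y₁)`, where `(x_i,y_i)` is the representative
digit sequence of `(x,y)`. -/
def Tmap {b : ℕ} {J : Finset (ℕ × ℕ)} (R : RepMap b J) (p : ℝ × ℝ) : ℝ × ℝ :=
  ((b : ℝ) * p.1 - ((R.rep p 1).1 : ℝ), (b : ℝ) * p.2 - ((R.rep p 1).2 : ℝ))

/-- The shrinking target set `Λ_{λ,ξ}(z,w)`. -/
def targetSet {b : ℕ} {J : Finset (ℕ × ℕ)} (R : RepMap b J) (lam xi : ℕ → ℕ)
    (z w : ℝ) : Set (ℝ × ℝ) :=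
  {p | p ∈ carpet b J ∧ ∃ᶠ n in atTop,
    ((Tmap R)^[n] p).1 ∈ Icc (z - (b : ℝ) ^ (-(lam n : ℤ))) (z + (b : ℝ) ^ (-(lam n : ℤ))) ∧
    ((Tmap R)^[n] p).2 ∈ Icc (w - (b : ℝ) ^ (-(xi n : ℤ))) (w + (b : ℝ) ^ (-(xi n : ℤ)))}

/-- The set `M_n(z,w)` (as a set of points of `Λ`, via representative sequences). -/
def Mset {b : ℕ} {J : Finset (ℕ × ℕ)} (R : RepMap b J) (lam xi : ℕ → ℕ)
    (zw : ℝ × ℝ) (n : ℕ) : Set (ℝ × ℝ) :=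
  {p | p ∈ carpet b J ∧
    closeCond b (lam n) n (fun i => (R.rep zw i).1) (fun i => (R.rep p i).1) ∧
    closeCond b (xi n) n (fun i => (R.rep zw i).2) (fun i => (R.rep p i).2)}

/-- `p_{n,j}(a,y) = #{λ(n) ≤ i ≤ j : y_{i+n} = a}`. -/
def pcount {b : ℕ} {J : Finset (ℕ × ℕ)} (R : RepMap b J) (lam : ℕ → ℕ)
    (p : ℝ × ℝ) (a n j : ℕ) : ℕ :=
  ((Finset.Icc (lam n) j).filter fun i => (R.rep p (i + n)).2 = a).card

/-- `A_{n,j}(z,w) = max_{(x,y) ∈ M_n(z,w)} Σ_a p_{n,j}(a,y) log #J₂(a)`. -/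
def Aval {b : ℕ} {J : Finset (ℕ × ℕ)} (R : RepMap b J) (lam xi : ℕ → ℕ)
    (zw : ℝ × ℝ) (n j : ℕ) : ℝ :=
  sSup ((fun p => ∑ a ∈ Finset.range b,
    (pcount R lam p a n j : ℝ) * Real.log ((J2 J a).card)) '' Mset R lam xi zw n)

/-- `s_n = min{ (n log #J + A_{n,j}(z,w)) / ((n+j) log b) : λ(n) ≤ j ≤ ξ(n) }`. -/
def sval {b : ℕ} {J : Finset (ℕ × ℕ)} (R : RepMap b J) (lam xi : ℕ → ℕ)
    (zw : ℝ × ℝ) (n : ℕ) : ℝ :=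
  sInf ((fun j : ℕ => ((n : ℝ) * Real.log J.card + Aval R lam xi zw n j) /
    (((n : ℝ) + (j : ℝ)) * Real.log b)) '' Set.Icc (lam n) (xi n))

/-- `#{1 ≤ i ≤ n : u i = a}`. -/
def freqCount (u : ℕ → ℕ) (a n : ℕ) : ℕ := ((Finset.Icc 1 n).filter fun i => u i = a).card

/-- The second-coordinate digit string of the representative sequence of a point. -/
def wdig {b : ℕ} {J : Finset (ℕ × ℕ)} (R : RepMap b J) (zw : ℝ × ℝ) (i : ℕ) : ℕ :=
  (R.rep zw i).2

/-- The integer whose base-`b` digits are `u 1, …, u m`. -/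
def pre (b : ℕ) (u : ℕ → ℕ) : ℕ → ℕ
  | 0 => 0
  | m + 1 => b * pre b u m + u (m + 1)

/-- The point of the plane coded by a sequence of pairs of digits. -/
def point (b : ℕ) (d : ℕ → ℕ × ℕ) : ℝ × ℝ :=
  (val b (fun i => (d i).1), val b (fun i => (d i).2))

section

variable {b : ℕ}

lemma summable_val (hb : 2 ≤ b) {u : ℕ → ℕ} (hu : ∀ i, 1 ≤ i → u i < b) :
    Summable fun i : ℕ => (u (i + 1) : ℝ) / (b : ℝ) ^ (i + 1) := by
  have hb' : (1 : ℝ) < b := by exact_mod_cast hb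
  have hg : Summable fun i : ℕ => ((b : ℝ)⁻¹) ^ i :=
    summable_geometric_of_lt_one (by positivity) (inv_lt_one_of_one_lt₀ hb')
  refine Summable.of_nonneg_of_le (fun i => by positivity) (fun i => ?_) hg
  rw [inv_pow, div_le_iff₀ (by positivity), pow_succ, inv_mul_cancel_left₀ (by positivity)]
  exact_mod_cast (hu (i + 1) (by omega)).le

lemma val_nonneg (b : ℕ) (u : ℕ → ℕ) : 0 ≤ val b u := tsum_nonneg fun i => by positivity

lemma val_congr {u v : ℕ → ℕ} (h : ∀ i, 1 ≤ i → u i = v i) : val b u = val b v := by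
  unfold val
  congr 1 with i
  rw [h (i + 1) (by omega)]

lemma point_congr {d e : ℕ → ℕ × ℕ} (h : ∀ i, 1 ≤ i → d i = e i) : point b d = point b e :=
  Prod.ext (val_congr (u := fun i => (d i).1) (v := fun i => (e i).1) fun i hi => by simp [h i hi])
    (val_congr (u := fun i => (d i).2) (v := fun i => (e i).2) fun i hi => by simp [h i hi])

lemma val_succ (hb : 2 ≤ b) {u : ℕ → ℕ} (hu : ∀ i, 1 ≤ i → u i < b) :
    (b : ℝ) * val b u = u 1 + val b (fun i => u (i + 1)) := by
  have hb' : (b : ℝ) ≠ 0 := by positivity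
  unfold val
  rw [(summable_val hb hu).tsum_eq_zero_add, mul_add, ← tsum_mul_left]
  congr 1
  · simp only [zero_add, pow_one]
    field_simp
  · congr 1 with i
    rw [pow_succ _ (i + 1)]
    field_simp

lemma val_max (hb : 2 ≤ b) : val b (fun _ => b - 1) = 1 := by
  have h := val_succ hb (u := fun _ => b - 1) (fun i _ => by omega)
  have hb' : (2 : ℝ) ≤ b := by exact_mod_cast hb
  rw [Nat.cast_sub (by omega)] at h
  push_cast at h
  have : ((b : ℝ) - 1) * (val b (fun _ => b - 1) - 1) = 0 := by linear_combination h
  rcases mul_eq_zero.1 this with h | h <;> linarith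

lemma val_add_compl (hb : 2 ≤ b) {u : ℕ → ℕ} (hu : ∀ i, 1 ≤ i → u i < b) :
    val b u + val b (fun i => b - 1 - u i) = 1 := by
  rw [← val_max hb]
  have h1 := summable_val hb hu
  have h2 : Summable fun i : ℕ => ((b - 1 - u (i + 1) : ℕ) : ℝ) / (b : ℝ) ^ (i + 1) :=
    summable_val (u := fun i => b - 1 - u i) hb (fun i hi => by have := hu i hi; omega)
  unfold val
  rw [← h1.tsum_add h2]
  congr 1 with i
  rw [← add_div, ← Nat.cast_add]
  congr 2
  have := hu (i + 1) (by omega)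
  simp only
  omega

lemma val_le_one (hb : 2 ≤ b) {u : ℕ → ℕ} (hu : ∀ i, 1 ≤ i → u i < b) : val b u ≤ 1 := by
  have := val_add_compl hb hu
  have := val_nonneg b (fun i => b - 1 - u i)
  linarith

lemma pow_mul_val (hb : 2 ≤ b) {u : ℕ → ℕ} (hu : ∀ i, 1 ≤ i → u i < b) (m : ℕ) :
    (b : ℝ) ^ m * val b u = pre b u m + val b (fun i => u (i + m)) := by
  induction m with
  | zero => simp [pre]
  | succ m ih =>
    have h := val_succ hb (u := fun i => u (i + m)) (fun i hi => hu _ (by omega))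
    have e : val b (fun i => u (i + 1 + m)) = val b (fun i => u (i + (m + 1))) :=
      val_congr fun i _ => by congr 1; omega
    rw [pow_succ, pre]
    push_cast
    rw [show 1 + m = m + 1 by omega, e] at h
    linear_combination b * ih + h

lemma pre_congr {u v : ℕ → ℕ} {m : ℕ} (h : ∀ i, 1 ≤ i → i ≤ m → u i = v i) :
    pre b u m = pre b v m := by
  induction m with
  | zero => rfl
  | succ m ih =>
    rw [pre, pre, ih fun i h1 h2 => h i h1 (by omega), h (m + 1) (by omega) le_rfl]

lemma digits_eq_of_pre_eq {u v : ℕ → ℕ} (hu : ∀ i, 1 ≤ i → u i < b)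
    (hv : ∀ i, 1 ≤ i → v i < b) {m : ℕ} (h : pre b u m = pre b v m) :
    ∀ i, 1 ≤ i → i ≤ m → u i = v i := by
  induction m with
  | zero => intro i h1 h2; omega
  | succ m ih =>
    rw [pre, pre] at h
    have hum := hu (m + 1) (by omega)
    have hvm := hv (m + 1) (by omega)
    have hd : u (m + 1) = v (m + 1) := by
      have := congrArg (· % b) h
      simpa [Nat.mul_add_mod, Nat.mod_eq_of_lt hum, Nat.mod_eq_of_lt hvm] using this
    have hp : pre b u m = pre b v m := by
      rw [hd] at h
      exact Nat.eq_of_mul_eq_mul_left (by omega) (Nat.add_right_cancel h)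
    intro i h1 h2
    rcases Nat.lt_or_ge m i with h3 | h3
    · rw [show i = m + 1 by omega, hd]
    · exact ih hp i h1 h3

lemma abs_val_sub_le (hb : 2 ≤ b) {u v : ℕ → ℕ} (hu : ∀ i, 1 ≤ i → u i < b)
    (hv : ∀ i, 1 ≤ i → v i < b) {m : ℕ} (h : ∀ i, 1 ≤ i → i ≤ m → u i = v i) :
    |val b u - val b v| ≤ ((b : ℝ) ^ m)⁻¹ := by
  have hpos : (0 : ℝ) < (b : ℝ) ^ m := by positivity
  rw [← mul_one ((b : ℝ) ^ m)⁻¹, le_inv_mul_iff₀ hpos, ← abs_of_pos hpos, ← abs_mul,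
    mul_sub, pow_mul_val hb hu, pow_mul_val hb hv, pre_congr h]
  have h1 := val_nonneg b (fun i => u (i + m))
  have h2 := val_nonneg b (fun i => v (i + m))
  have h3 := val_le_one hb (u := fun i => u (i + m)) (fun i hi => hu _ (by omega))
  have h4 := val_le_one hb (u := fun i => v (i + m)) (fun i hi => hv _ (by omega))
  rw [abs_le]
  constructor <;> linarith

lemma abs_pre_sub_le (hb : 2 ≤ b) {u v : ℕ → ℕ} (hu : ∀ i, 1 ≤ i → u i < b)
    (hv : ∀ i, 1 ≤ i → v i < b) {m : ℕ} (h : |val b u - val b v| ≤ ((b : ℝ) ^ m)⁻¹) :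
    |(pre b u m : ℤ) - pre b v m| ≤ 2 := by
  have hpos : (0 : ℝ) < (b : ℝ) ^ m := by positivity
  rw [← mul_one ((b : ℝ) ^ m)⁻¹, le_inv_mul_iff₀ hpos, ← abs_of_pos hpos, ← abs_mul,
    mul_sub, pow_mul_val hb hu, pow_mul_val hb hv, abs_le] at h
  have h1 := val_nonneg b (fun i => u (i + m))
  have h2 := val_nonneg b (fun i => v (i + m))
  have h3 := val_le_one hb (u := fun i => u (i + m)) (fun i hi => hu _ (by omega))
  have h4 := val_le_one hb (u := fun i => v (i + m)) (fun i hi => hv _ (by omega))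
  have : |((pre b u m : ℤ) - pre b v m : ℝ)| ≤ 2 := by
    rw [abs_le]
    push_cast
    constructor <;> linarith [h.1, h.2]
  exact_mod_cast this

/-- If `v` exceeds `w` at the first index `k` where they differ, then closeness of the values
forces the digits of `w` after `k` to be maximal. -/
lemma digits_max_of_val_close (hb : 2 ≤ b) {v w : ℕ → ℕ} (hv : ∀ i, 1 ≤ i → v i < b)
    (hw : ∀ i, 1 ≤ i → w i < b) {k L : ℕ} (hk : ∀ i, 1 ≤ i → i ≤ k → v i = w i)
    (hlt : w (k + 1) < v (k + 1)) (h : val b v - val b w ≤ ((b : ℝ) ^ L)⁻¹) :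
    ∀ i, k + 1 < i → i < L → w i = b - 1 := by
  intro i hi hiL
  by_contra hne
  have hb0 : (0 : ℝ) < b := by positivity
  have hp : pre b v (k + 1) ≥ pre b w (k + 1) + 1 := by
    rw [pre, pre, pre_congr hk]; omega
  have hp' : (pre b v (k + 1) : ℝ) ≥ pre b w (k + 1) + 1 := by exact_mod_cast hp
  have e1 := pow_mul_val hb hv (k + 1)
  have e2 := pow_mul_val hb hw (k + 1)
  have e3 := val_add_compl hb (u := fun i => w (i + (k + 1))) (fun i hi => hw _ (by omega))
  have n1 := val_nonneg b (fun i => v (i + (k + 1)))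
  have hsum := summable_val hb (u := fun i => b - 1 - w (i + (k + 1)))
    (fun i hi => by omega)
  have hterm : ((b : ℝ) ^ (i - (k + 1)))⁻¹ ≤ val b (fun i => b - 1 - w (i + (k + 1))) := by
    have := hsum.le_tsum (i - (k + 1) - 1) (fun j _ => by positivity)
    refine le_trans ?_ this
    rw [show i - (k + 1) - 1 + 1 = i - (k + 1) by omega, inv_eq_one_div]
    gcongr
    have := hw i (by omega)
    rw [show i - (k + 1) + (k + 1) = i by omega]
    have : 1 ≤ b - 1 - w i := by omega
    exact_mod_cast this
  have hlow : ((b : ℝ) ^ (i - (k + 1)))⁻¹ ≤ (b : ℝ) ^ (k + 1) * (val b v - val b w) := by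
    rw [mul_sub, e1, e2]; linarith
  have hup : (b : ℝ) ^ (k + 1) * (val b v - val b w) ≤ (b : ℝ) ^ (k + 1) * ((b : ℝ) ^ L)⁻¹ := by
    gcongr
  have := hlow.trans hup
  have hpow : (b : ℝ) ^ (k + 1) * ((b : ℝ) ^ L)⁻¹ = ((b : ℝ) ^ (L - (k + 1)))⁻¹ := by
    rw [show (b : ℝ) ^ L = (b : ℝ) ^ (k + 1) * (b : ℝ) ^ (L - (k + 1)) by
      rw [← pow_add]; congr 1; omega]
    field_simp
  rw [hpow, inv_le_inv₀ (by positivity) (by positivity)] at this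
  have hbb : (1 : ℝ) < b := by exact_mod_cast hb
  have := (pow_le_pow_iff_right₀ hbb).1 this
  omega

/-- The mirror image of `digits_max_of_val_close`. -/
lemma digits_zero_of_val_close (hb : 2 ≤ b) {v w : ℕ → ℕ} (hv : ∀ i, 1 ≤ i → v i < b)
    (hw : ∀ i, 1 ≤ i → w i < b) {k L : ℕ} (hk : ∀ i, 1 ≤ i → i ≤ k → v i = w i)
    (hlt : v (k + 1) < w (k + 1)) (h : val b w - val b v ≤ ((b : ℝ) ^ L)⁻¹) :
    ∀ i, k + 1 < i → i < L → w i = 0 := by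
  intro i hi hiL
  have hv' := val_add_compl hb hv
  have hw' := val_add_compl hb hw
  have := digits_max_of_val_close hb (v := fun i => b - 1 - v i) (w := fun i => b - 1 - w i)
    (fun i _ => by omega) (fun i _ => by omega) (k := k) (L := L)
    (fun i h1 h2 => by simp only [hk i h1 h2])
    (by have := hw (k + 1) (by omega); have := hv (k + 1) (by omega); omega)
    (by linarith) i hi hiL
  have := hw i (by omega)
  omega

/-- Two digit strings with the same value which first differ after index `k` end in constant
runs of `0` and `b - 1`. -/
lemma exists_digits_of_val_eq (hb : 2 ≤ b) {v w : ℕ → ℕ} (hv : ∀ i, 1 ≤ i → v i < b)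
    (hw : ∀ i, 1 ≤ i → w i < b) (h : val b v = val b w) (hne : ∃ i, 1 ≤ i ∧ v i ≠ w i) :
    ∃ k, (∀ i, k < i → v i = 0 ∧ w i = b - 1) ∨ (∀ i, k < i → v i = b - 1 ∧ w i = 0) := by
  classical
  obtain ⟨hn1, hn2⟩ := Nat.find_spec hne
  set n := Nat.find hne with hn
  have hlt : ∀ i, 1 ≤ i → i ≤ n - 1 → v i = w i := by
    intro i h1 h2
    by_contra hc
    exact Nat.find_min hne (m := i) (by omega) ⟨h1, hc⟩
  have hn' : n - 1 + 1 = n := by omega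
  have h0 : ∀ L : ℕ, (0 : ℝ) ≤ ((b : ℝ) ^ L)⁻¹ := fun L => by positivity
  refine ⟨n, ?_⟩
  rcases lt_or_gt_of_ne hn2 with hc | hc
  · right
    intro i hi
    exact ⟨digits_max_of_val_close hb hw hv (k := n - 1) (L := i + 1)
        (fun j h1 h2 => (hlt j h1 h2).symm) (by rwa [hn'])
        (by rw [h, sub_self]; exact h0 _) i (by omega) (by omega),
      digits_zero_of_val_close hb hv hw (k := n - 1) (L := i + 1) hlt (by rwa [hn'])
        (by rw [h, sub_self]; exact h0 _) i (by omega) (by omega)⟩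
  · left
    intro i hi
    exact ⟨digits_zero_of_val_close hb hw hv (k := n - 1) (L := i + 1)
        (fun j h1 h2 => (hlt j h1 h2).symm) (by rwa [hn'])
        (by rw [h, sub_self]; exact h0 _) i (by omega) (by omega),
      digits_max_of_val_close hb hv hw (k := n - 1) (L := i + 1) hlt (by rwa [hn'])
        (by rw [h, sub_self]; exact h0 _) i (by omega) (by omega)⟩

lemma fst_lt_of_mem {J : Finset (ℕ × ℕ)} (hJ : J ⊆ Finset.range b ×ˢ Finset.range b)
    {d : ℕ → ℕ × ℕ} (hd : ∀ i, 1 ≤ i → d i ∈ J) (i : ℕ) (hi : 1 ≤ i) : (d i).1 < b := by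
  have := hJ (hd i hi)
  simp only [Finset.mem_product, Finset.mem_range] at this
  exact this.1

lemma snd_lt_of_mem {J : Finset (ℕ × ℕ)} (hJ : J ⊆ Finset.range b ×ˢ Finset.range b)
    {d : ℕ → ℕ × ℕ} (hd : ∀ i, 1 ≤ i → d i ∈ J) (i : ℕ) (hi : 1 ≤ i) : (d i).2 < b := by
  have := hJ (hd i hi)
  simp only [Finset.mem_product, Finset.mem_range] at this
  exact this.2

lemma point_mem_carpet {J : Finset (ℕ × ℕ)} {d : ℕ → ℕ × ℕ} (hd : ∀ i, 1 ≤ i → d i ∈ J) :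
    point b d ∈ carpet b J := ⟨d, hd, rfl⟩

/-- The first `n` steps of an orbit are read off from some digit sequence of the point. -/
lemma exists_orbit_code (hb : 2 ≤ b) {J : Finset (ℕ × ℕ)}
    (hJ : J ⊆ Finset.range b ×ˢ Finset.range b) (R : RepMap b J) (n : ℕ) :
    ∀ p ∈ carpet b J, ∃ d : ℕ → ℕ × ℕ, (∀ i, 1 ≤ i → d i ∈ J) ∧ p = point b d ∧
      (Tmap R)^[n] p = point b (fun i => d (i + n)) := by
  induction n with
  | zero =>
    rintro p ⟨d, hd, rfl⟩
    exact ⟨d, hd, rfl, rfl⟩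
  | succ n ih =>
    intro p hp
    have hr := R.mem_J p hp
    have he := R.eq_val p hp
    have hT : Tmap R p = point b (fun i => R.rep p (i + 1)) := by
      have h1 := val_succ hb (u := fun i => (R.rep p i).1) (fst_lt_of_mem hJ hr)
      have h2 := val_succ hb (u := fun i => (R.rep p i).2) (snd_lt_of_mem hJ hr)
      have e1 := congrArg Prod.fst he
      have e2 := congrArg Prod.snd he
      simp only at e1 e2
      refine Prod.ext ?_ ?_
      · simp only [Tmap, point]
        rw [e1]
        linarith
      · simp only [Tmap, point]
        rw [e2]
        linarith
    obtain ⟨d, hd, h1, h2⟩ := ih (Tmap R p) (hT ▸ point_mem_carpet fun i hi => hr _ (by omega))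
    have hd' : ∀ i, 1 ≤ i → (fun i => if i = 1 then R.rep p 1 else d (i - 1)) i ∈ J := by
      intro i hi
      by_cases h : i = 1
      · simpa [h] using hr 1 le_rfl
      · simpa [h] using hd (i - 1) (by omega)
    refine ⟨fun i => if i = 1 then R.rep p 1 else d (i - 1), hd', ?_, ?_⟩
    · have hb0 : (b : ℝ) ≠ 0 := by positivity
      have g1 := val_succ hb (fst_lt_of_mem hJ hd')
      have g2 := val_succ hb (snd_lt_of_mem hJ hd')
      have f1 := congrArg Prod.fst h1
      have f2 := congrArg Prod.snd h1
      simp only [Tmap, point] at f1 f2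
      have c1 : val b (fun i => (if i + 1 = 1 then R.rep p 1 else d (i + 1 - 1)).1)
          = val b (fun i => (d i).1) := val_congr fun i hi => by
        rw [if_neg (by omega), Nat.add_sub_cancel]
      have c2 : val b (fun i => (if i + 1 = 1 then R.rep p 1 else d (i + 1 - 1)).2)
          = val b (fun i => (d i).2) := val_congr fun i hi => by
        rw [if_neg (by omega), Nat.add_sub_cancel]
      rw [c1, ← f1] at g1
      rw [c2, ← f2] at g2
      simp only [if_true] at g1 g2
      refine Prod.ext ?_ ?_
      · apply mul_left_cancel₀ hb0
        simp only [point]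
        rw [g1]
        ring
      · apply mul_left_cancel₀ hb0
        simp only [point]
        rw [g2]
        ring
    · rw [Function.iterate_succ_apply, h2]
      refine point_congr fun i hi => ?_
      simp only
      rw [if_neg (by omega)]
      congr 1

/-- A digit sequence in which every digit recurs is the only one representing its point. -/
lemma code_unique (hb : 2 ≤ b) {J : Finset (ℕ × ℕ)}
    (hJ : J ⊆ Finset.range b ×ˢ Finset.range b) {d e : ℕ → ℕ × ℕ}
    (hd : ∀ i, 1 ≤ i → d i ∈ J) (he : ∀ i, 1 ≤ i → e i ∈ J)
    (hrec : ∀ a ∈ J, ∃ᶠ i in atTop, d i = a) (h : point b d = point b e) :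
    ∀ i, 1 ≤ i → d i = e i := by
  have key : ∀ f : ℕ × ℕ → ℕ, (∀ i, 1 ≤ i → f (d i) < b) → (∀ i, 1 ≤ i → f (e i) < b) →
      val b (fun i => f (d i)) = val b (fun i => f (e i)) → ∀ i, 1 ≤ i → f (d i) = f (e i) := by
    intro f h1 h2 hv
    by_contra! hne
    obtain ⟨k, hk⟩ := exists_digits_of_val_eq hb h1 h2 hv hne
    obtain ⟨i, hi, hdi⟩ := (frequently_atTop.1 (hrec _ (he (k + 1) (by omega)))) (k + 1)
    have hfi := congrArg f hdi
    rcases hk with hk | hk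
    · have := (hk i (by omega)).1
      have := (hk (k + 1) (by omega)).2
      omega
    · have := (hk i (by omega)).1
      have := (hk (k + 1) (by omega)).2
      omega
  intro i hi
  exact Prod.ext
    (key Prod.fst (fst_lt_of_mem hJ hd) (fst_lt_of_mem hJ he) (congrArg Prod.fst h) i hi)
    (key Prod.snd (snd_lt_of_mem hJ hd) (snd_lt_of_mem hJ he) (congrArg Prod.snd h) i hi)

/-- The points with a digit sequence whose `n`-th shift lies in the `n`-th target. -/
def hitSet (b : ℕ) (J : Finset (ℕ × ℕ)) (lam xi : ℕ → ℕ) (z w : ℝ) (n : ℕ) : Set (ℝ × ℝ) :=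
  point b '' {d | (∀ i, 1 ≤ i → d i ∈ J) ∧
    |val b (fun i => (d (i + n)).1) - z| ≤ ((b : ℝ) ^ lam n)⁻¹ ∧
    |val b (fun i => (d (i + n)).2) - w| ≤ ((b : ℝ) ^ xi n)⁻¹}

lemma mem_Icc_iff_abs (b : ℕ) (x z : ℝ) (k : ℕ) :
    x ∈ Icc (z - (b : ℝ) ^ (-(k : ℤ))) (z + (b : ℝ) ^ (-(k : ℤ))) ↔
      |x - z| ≤ ((b : ℝ) ^ k)⁻¹ := by
  rw [zpow_neg, zpow_natCast, abs_le, mem_Icc]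
  constructor <;> rintro ⟨h1, h2⟩ <;> constructor <;> linarith

lemma targetSet_subset (hb : 2 ≤ b) {J : Finset (ℕ × ℕ)}
    (hJ : J ⊆ Finset.range b ×ˢ Finset.range b) (R : RepMap b J) (lam xi : ℕ → ℕ) (z w : ℝ) :
    targetSet R lam xi z w ⊆ {p | ∃ᶠ n in atTop, p ∈ hitSet b J lam xi z w n} := by
  rintro p ⟨hp, hf⟩
  refine hf.mono fun n hn => ?_
  obtain ⟨d, hd, hpd, hT⟩ := exists_orbit_code hb hJ R n p hp
  rw [mem_Icc_iff_abs, mem_Icc_iff_abs, hT] at hn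
  exact ⟨d, ⟨hd, hn⟩, hpd.symm⟩

lemma point_mem_targetSet (hb : 2 ≤ b) {J : Finset (ℕ × ℕ)}
    (hJ : J ⊆ Finset.range b ×ˢ Finset.range b) (R : RepMap b J) (lam xi : ℕ → ℕ) (z w : ℝ)
    {d : ℕ → ℕ × ℕ} (hd : ∀ i, 1 ≤ i → d i ∈ J) (hrec : ∀ a ∈ J, ∃ᶠ i in atTop, d i = a)
    (hit : ∃ᶠ n in atTop, |val b (fun i => (d (i + n)).1) - z| ≤ ((b : ℝ) ^ lam n)⁻¹ ∧
      |val b (fun i => (d (i + n)).2) - w| ≤ ((b : ℝ) ^ xi n)⁻¹) :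
    point b d ∈ targetSet R lam xi z w := by
  refine ⟨point_mem_carpet hd, hit.mono fun n hn => ?_⟩
  obtain ⟨e, he, hpe, hT⟩ := exists_orbit_code hb hJ R n _ (point_mem_carpet (b := b) hd)
  have heq := code_unique hb hJ hd he hrec hpe
  rw [mem_Icc_iff_abs, mem_Icc_iff_abs, hT,
    ← point_congr (d := fun i => d (i + n)) fun i hi => heq _ (by omega)]
  exact hn

/-- A Borel–Cantelli upper bound for the dimension of a limsup set. -/
lemma dimH_limsup_le {X : Type*} [EMetricSpace X] (E : ℕ → Set X) (s : ℝ≥0) (C : ℝ) (a : ℕ → ℝ)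
    (ha : Summable a)
    (hE : ∀ᶠ n in atTop, ∃ (c : ℕ) (r : ℝ), 0 ≤ r ∧ r ≤ C * (1 / 2) ^ n ∧
      c * r ^ (s : ℝ) ≤ a n ∧ ∃ t : Fin c → Set X, E n ⊆ ⋃ i, t i ∧
        ∀ i, Metric.ediam (t i) ≤ ENNReal.ofReal r) :
    dimH {p | ∃ᶠ n in atTop, p ∈ E n} ≤ s := by
  obtain ⟨N, hN⟩ := eventually_atTop.1 hE
  have hN' : ∀ n, ∃ (c : ℕ) (r : ℝ), 0 ≤ r ∧ r ≤ C * (1 / 2) ^ (n + N) ∧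
      c * r ^ (s : ℝ) ≤ a (n + N) ∧ ∃ t : Fin c → Set X, E (n + N) ⊆ ⋃ i, t i ∧
        ∀ i, Metric.ediam (t i) ≤ ENNReal.ofReal r := fun n => hN (n + N) (by omega)
  choose c r hr0 hr hc t ht hd using hN'
  have hC : 0 ≤ C := by
    have := (hr0 0).trans (hr 0)
    by_contra! h
    have : C * (1 / 2 : ℝ) ^ (0 + N) < 0 := mul_neg_of_neg_of_pos h (by positivity)
    linarith
  have hsum : ∑' n, ENNReal.ofReal (a (n + N)) ≠ ∞ := by
    have h1 : Summable fun n => a (n + N) := (summable_nat_add_iff N).2 ha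
    exact h1.tsum_ofReal_ne_top
  borelize X
  apply dimH_le_of_hausdorffMeasure_ne_top
  have hle := Measure.hausdorffMeasure_le_liminf_tsum (ι := fun M : ℕ => Σ n : ℕ, Fin (c (n + M)))
    (s : ℝ) {p | ∃ᶠ n in atTop, p ∈ E n} (l := atTop)
    (fun M => ENNReal.ofReal (C * (1 / 2) ^ M)) ?_ (fun M x => t (x.1 + M) x.2) ?_ ?_
  · refine ne_top_of_le_ne_top ENNReal.zero_ne_top (hle.trans ?_)
    refine le_trans (liminf_le_liminf (v := fun M => ∑' n, ENNReal.ofReal (a (n + M + N))) ?_) ?_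
    · refine Eventually.of_forall fun M => ?_
      rw [ENNReal.tsum_sigma']
      refine ENNReal.tsum_le_tsum fun n => ?_
      rw [tsum_fintype]
      refine (Finset.sum_le_sum (g := fun _ => ENNReal.ofReal (r (n + M)) ^ (s : ℝ)) fun i _ =>
        ENNReal.rpow_le_rpow (hd _ _) s.2).trans ?_
      rw [Finset.sum_const, Finset.card_univ, Fintype.card_fin, nsmul_eq_mul,
        ENNReal.ofReal_rpow_of_nonneg (hr0 _) s.coe_nonneg, ← ENNReal.ofReal_natCast,
        ← ENNReal.ofReal_mul (by positivity)]
      exact ENNReal.ofReal_le_ofReal (hc _)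
    · exact (ENNReal.tendsto_sum_nat_add (fun n => ENNReal.ofReal (a (n + N))) hsum).liminf_eq.le
  · rw [← ENNReal.ofReal_zero]
    refine ENNReal.tendsto_ofReal ?_
    rw [← mul_zero C]
    exact (tendsto_pow_atTop_nhds_zero_of_lt_one (by norm_num) (by norm_num)).const_mul C
  · refine Eventually.of_forall fun M x => (hd _ _).trans (ENNReal.ofReal_le_ofReal ?_)
    refine (hr _).trans (mul_le_mul_of_nonneg_left ?_ hC)
    exact pow_le_pow_of_le_one (by norm_num) (by norm_num) (by omega)
  · refine Eventually.of_forall fun M p hp => ?_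
    obtain ⟨n, hn, hpn⟩ := frequently_atTop.1 hp (M + N)
    obtain ⟨m, rfl⟩ := Nat.exists_eq_add_of_le hn
    have hpn' : p ∈ E (m + M + N) := by convert hpn using 2; omega
    obtain ⟨i, hi⟩ := mem_iUnion.1 (ht (m + M) hpn')
    exact mem_iUnion.2 ⟨⟨m, i⟩, hi⟩

/-- Covering an image by the fibres of a coding with finitely many codes. -/
lemma exists_cover_of_code {Y X ι : Type*} [PseudoMetricSpace X] (f : Y → X) (D : Set Y)
    (code : Y → ι) (C : Finset ι) (hC : ∀ d ∈ D, code d ∈ C) {r : ℝ}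
    (hr : ∀ d ∈ D, ∀ e ∈ D, code d = code e → dist (f d) (f e) ≤ r) :
    ∃ t : Fin C.card → Set X, f '' D ⊆ ⋃ i, t i ∧
      ∀ i, Metric.ediam (t i) ≤ ENNReal.ofReal r := by
  refine ⟨fun i => f '' {d ∈ D | code d = C.equivFin.symm i}, ?_, fun i => ?_⟩
  · rintro _ ⟨d, hd, rfl⟩
    refine mem_iUnion.2 ⟨C.equivFin ⟨code d, hC d hd⟩, d, ⟨hd, ?_⟩, rfl⟩
    simp
  · refine Metric.ediam_le ?_
    rintro _ ⟨d, ⟨hd, h1⟩, rfl⟩ _ ⟨e, ⟨he, h2⟩, rfl⟩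
    rw [edist_dist]
    exact ENNReal.ofReal_le_ofReal (hr d hd e he (h1.trans h2.symm))

/-- Truncation of a pair of naturals to a pair of base-`b` digits. -/
def clamp (b : ℕ) (e : ℕ × ℕ) : ℕ × ℕ := (min e.1 (b - 1), min e.2 (b - 1))

lemma clamp_eq_self {e : ℕ × ℕ} (he : e ∈ Finset.range b ×ˢ Finset.range b) : clamp b e = e := by
  simp only [Finset.mem_product, Finset.mem_range] at he
  exact Prod.ext (min_eq_left (by omega)) (min_eq_left (by omega))

lemma measurable_pre {Ω : Type*} [MeasurableSpace Ω] {u : Ω → ℕ → ℕ}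
    (hu : ∀ i, Measurable fun ω => u ω i) (m : ℕ) : Measurable fun ω => pre b (u ω) m := by
  induction m with
  | zero => exact measurable_const
  | succ m ih => exact (ih.const_mul b).add (hu (m + 1))

lemma tendsto_pre_div (hb : 2 ≤ b) {u : ℕ → ℕ} (hu : ∀ i, 1 ≤ i → u i < b) :
    Tendsto (fun m => (pre b u m : ℝ) / (b : ℝ) ^ m) atTop (𝓝 (val b u)) := by
  have hb' : (1 : ℝ) < b := by exact_mod_cast hb
  have h0 : Tendsto (fun m : ℕ => val b u - ((b : ℝ)⁻¹) ^ m) atTop (𝓝 (val b u)) := by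
    simpa using (tendsto_pow_atTop_nhds_zero_of_lt_one (r := (b : ℝ)⁻¹) (by positivity)
      (inv_lt_one_of_one_lt₀ hb')).const_sub (val b u)
  refine tendsto_of_tendsto_of_tendsto_of_le_of_le h0 tendsto_const_nhds (fun m => ?_) fun m => ?_
  all_goals
    have hp : (0 : ℝ) < (b : ℝ) ^ m := by positivity
    have h1 := pow_mul_val hb hu m
    have h2 := val_nonneg b (fun i => u (i + m))
    have h3 := val_le_one hb (u := fun i => u (i + m)) (fun i hi => hu _ (by omega))
  · simp only [inv_pow]
    rw [le_div_iff₀ hp, sub_mul, inv_mul_cancel₀ hp.ne']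
    linarith
  · simp only
    rw [div_le_iff₀ hp]
    linarith

lemma measurable_val {Ω : Type*} [MeasurableSpace Ω] (hb : 2 ≤ b) {u : Ω → ℕ → ℕ}
    (hu : ∀ i, Measurable fun ω => u ω i) (hlt : ∀ ω i, 1 ≤ i → u ω i < b) :
    Measurable fun ω => val b (u ω) := by
  refine measurable_of_tendsto_metrizable (f := fun m ω => (pre b (u ω) m : ℝ) / (b : ℝ) ^ m)
    (fun m => ?_) (tendsto_pi_nhds.2 fun ω => tendsto_pre_div hb (hlt ω))
  exact (measurable_from_nat.comp (measurable_pre hu m)).div_const _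

/-- The product of the uniform measures on the finite sets `D i`. -/
def unifProd (D : ℕ → Finset (ℕ × ℕ)) (hne : ∀ i, (D i).Nonempty) : Measure (ℕ → ℕ × ℕ) :=
  Measure.infinitePi fun i => (PMF.uniformOfFinset (D i) (hne i)).toMeasure

lemma unifProd_cylinder_le (D : ℕ → Finset (ℕ × ℕ)) (hne : ∀ i, (D i).Nonempty)
    (hD : ∀ i, 1 ≤ i → D i ⊆ Finset.range b ×ˢ Finset.range b) (m : ℕ) (a : ℕ → ℕ × ℕ) :
    unifProd D hne {ω | ∀ i, 1 ≤ i → i ≤ m → clamp b (ω i) = a i} ≤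
      (((∏ i ∈ Finset.Icc 1 m, (D i).card : ℕ) : ℝ≥0∞))⁻¹ := by
  have hset : {ω : ℕ → ℕ × ℕ | ∀ i, 1 ≤ i → i ≤ m → clamp b (ω i) = a i} =
      Set.pi (Finset.Icc 1 m : Finset ℕ) fun i => {e | clamp b e = a i} := by
    ext ω
    simp only [mem_ofPred_eq, Set.mem_pi, Finset.coe_Icc, mem_Icc, and_imp]
  rw [hset, unifProd, Measure.infinitePi_pi _ fun i _ => MeasurableSet.of_discrete, Nat.cast_prod,
    ENNReal.prod_inv_distrib]
  · refine Finset.prod_le_prod' fun i hi => ?_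
    rw [PMF.toMeasure_uniformOfFinset_apply _ _ MeasurableSet.of_discrete, inv_eq_one_div]
    gcongr
    rw [← Nat.cast_one (R := ℝ≥0∞), Nat.cast_le, Finset.card_le_one]
    intro x hx y hy
    simp only [Finset.mem_filter, mem_ofPred_eq] at hx hy
    have hi' := hD i (Finset.mem_Icc.1 hi).1
    rw [← clamp_eq_self (hi' hx.1), ← clamp_eq_self (hi' hy.1), hx.2, hy.2]
  · intro i _ j _ _
    exact Or.inl (by simpa using (hne i).ne_empty)

lemma unifProd_preimage_le (hb : 2 ≤ b) (D : ℕ → Finset (ℕ × ℕ)) (hne : ∀ i, (D i).Nonempty)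
    (hD : ∀ i, 1 ≤ i → D i ⊆ Finset.range b ×ˢ Finset.range b) (m : ℕ) (A : Set (ℝ × ℝ))
    (hA : Metric.ediam A ≤ ENNReal.ofReal (((b : ℝ) ^ m)⁻¹)) :
    unifProd D hne ((fun ω => point b fun i => clamp b (ω i)) ⁻¹' A) ≤
      25 * (((∏ i ∈ Finset.Icc 1 m, (D i).card : ℕ) : ℝ≥0∞))⁻¹ := by
  rcases ((fun ω : ℕ → ℕ × ℕ => point b fun i => clamp b (ω i)) ⁻¹' A).eq_empty_or_nonempty with
    h0 | ⟨ω₀, hω₀⟩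
  · rw [h0]; simp
  have hlt1 : ∀ (ω : ℕ → ℕ × ℕ) (i : ℕ), 1 ≤ i → (clamp b (ω i)).1 < b := fun ω i _ => by
    simp only [clamp]; omega
  have hlt2 : ∀ (ω : ℕ → ℕ × ℕ) (i : ℕ), 1 ≤ i → (clamp b (ω i)).2 < b := fun ω i _ => by
    simp only [clamp]; omega
  let X : (ℕ → ℕ × ℕ) → ℤ := fun ω => (pre b (fun i => (clamp b (ω i)).1) m : ℤ)
  let Y : (ℕ → ℕ × ℕ) → ℤ := fun ω => (pre b (fun i => (clamp b (ω i)).2) m : ℤ)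
  let I : Finset (ℤ × ℤ) := Finset.Icc (-2) 2 ×ˢ Finset.Icc (-2) 2
  have hcov : (fun ω : ℕ → ℕ × ℕ => point b fun i => clamp b (ω i)) ⁻¹' A ⊆
      ⋃ k ∈ I, {ω | X ω - X ω₀ = k.1 ∧ Y ω - Y ω₀ = k.2} := by
    intro ω hω
    have hd : dist (point b fun i => clamp b (ω i)) (point b fun i => clamp b (ω₀ i)) ≤
        ((b : ℝ) ^ m)⁻¹ := by
      have := (Metric.edist_le_ediam_of_mem (mem_preimage.1 hω) (mem_preimage.1 hω₀)).trans hA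
      rw [edist_dist] at this
      exact (ENNReal.ofReal_le_ofReal_iff (by positivity)).1 this
    rw [Prod.dist_eq, max_le_iff, Real.dist_eq, Real.dist_eq] at hd
    have h1 := abs_le.1 (abs_pre_sub_le hb (hlt1 ω) (hlt1 ω₀) hd.1)
    have h2 := abs_le.1 (abs_pre_sub_le hb (hlt2 ω) (hlt2 ω₀) hd.2)
    simp only [mem_iUnion, exists_prop]
    refine ⟨(X ω - X ω₀, Y ω - Y ω₀), ?_, rfl, rfl⟩
    simp only [I, Finset.mem_product, Finset.mem_Icc]
    exact ⟨h1, h2⟩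
  refine (measure_mono hcov).trans ((measure_biUnion_finset_le _ _).trans ?_)
  refine (Finset.sum_le_card_nsmul _ _ _ fun k _ => ?_).trans (b := I.card •
    (((∏ i ∈ Finset.Icc 1 m, (D i).card : ℕ) : ℝ≥0∞))⁻¹) ?_
  · rcases {ω | X ω - X ω₀ = k.1 ∧ Y ω - Y ω₀ = k.2}.eq_empty_or_nonempty with h0 | ⟨ω₁, h1, h2⟩
    · rw [h0]; simp
    · refine le_trans (measure_mono ?_)
        (unifProd_cylinder_le D hne hD m fun i => clamp b (ω₁ i))
      rintro ω ⟨h3, h4⟩ i hi him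
      have h5 : X ω = X ω₁ := by linarith
      have h6 : Y ω = Y ω₁ := by linarith
      exact Prod.ext
        (digits_eq_of_pre_eq (hlt1 ω) (hlt1 ω₁) (Int.natCast_inj.1 h5) i hi him)
        (digits_eq_of_pre_eq (hlt2 ω) (hlt2 ω₁) (Int.natCast_inj.1 h6) i hi him)
  · rw [nsmul_eq_mul]
    have : I.card = 25 := by decide
    rw [this]
    norm_num

instance (D : ℕ → Finset (ℕ × ℕ)) (hne : ∀ i, (D i).Nonempty) :
    IsProbabilityMeasure (unifProd D hne) := by
  unfold unifProd; infer_instance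

lemma ae_unifProd_mem (D : ℕ → Finset (ℕ × ℕ)) (hne : ∀ i, (D i).Nonempty) :
    ∀ᵐ ω ∂unifProd D hne, ∀ i, ω i ∈ D i := by
  refine ae_all_iff.2 fun i => ?_
  refine (measurePreserving_eval_infinitePi (fun i => (PMF.uniformOfFinset (D i)
    (hne i)).toMeasure) i).quasiMeasurePreserving.ae (p := fun e => e ∈ D i) ?_
  rw [ae_iff, PMF.toMeasure_apply_eq_zero_iff _ MeasurableSet.of_discrete,
    PMF.support_uniformOfFinset, Set.disjoint_left]
  intro e he h
  exact h he

lemma measurable_point_clamp (hb : 2 ≤ b) :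
    Measurable fun ω : ℕ → ℕ × ℕ => point b fun i => clamp b (ω i) := by
  have h1 : Measurable fun e : ℕ × ℕ => (clamp b e).1 := Measurable.of_discrete
  have h2 : Measurable fun e : ℕ × ℕ => (clamp b e).2 := Measurable.of_discrete
  have hlt : ∀ e, (clamp b e).1 < b ∧ (clamp b e).2 < b := fun e => by
    simp only [clamp]
    omega
  have m1 : Measurable fun ω : ℕ → ℕ × ℕ => val b fun i => (clamp b (ω i)).1 :=
    measurable_val hb (fun i => h1.comp (measurable_pi_apply i)) fun ω i _ => (hlt (ω i)).1
  have m2 : Measurable fun ω : ℕ → ℕ × ℕ => val b fun i => (clamp b (ω i)).2 :=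
    measurable_val hb (fun i => h2.comp (measurable_pi_apply i)) fun ω i _ => (hlt (ω i)).2
  exact m1.prodMk m2

/-- Lower bound for the dimension of the set of points with `i`-th digit in `D i`. -/
lemma le_dimH_digit_set (hb : 2 ≤ b) (D : ℕ → Finset (ℕ × ℕ)) (hne : ∀ i, (D i).Nonempty)
    (hD : ∀ i, 1 ≤ i → D i ⊆ Finset.range b ×ˢ Finset.range b) (s : ℝ≥0) (hs : 0 < s) {c : ℝ}
    (hc : 0 < c) (hmass : ∀ m : ℕ, c * ((b : ℝ) ^ m) ^ (s : ℝ) ≤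
      ((∏ i ∈ Finset.Icc 1 m, (D i).card : ℕ) : ℝ)) :
    (s : ℝ≥0∞) ≤ dimH (point b '' {d | ∀ i, 1 ≤ i → d i ∈ D i}) := by
  have hb' : (1 : ℝ) < b := by exact_mod_cast hb
  have hs' : (0 : ℝ) < s := by exact_mod_cast hs
  set f : (ℕ → ℕ × ℕ) → ℝ × ℝ := fun ω => point b fun i => clamp b (ω i) with hf
  have hfm : Measurable f := measurable_point_clamp hb
  set μ := (unifProd D hne).map f with hμ
  set κ : ℝ := c / 25 * ((b : ℝ) ^ (s : ℝ))⁻¹ with hκ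
  have hκ0 : 0 < κ := by positivity
  have key : ∀ (m : ℕ) (A : Set (ℝ × ℝ)), Metric.ediam A ≤ ENNReal.ofReal (((b : ℝ) ^ m)⁻¹) →
      ENNReal.ofReal κ * μ A ≤ ENNReal.ofReal (((b : ℝ) ^ (m + 1))⁻¹ ^ (s : ℝ)) := by
    intro m A hA
    have h1 : μ A ≤ 25 * (((∏ i ∈ Finset.Icc 1 m, (D i).card : ℕ) : ℝ≥0∞))⁻¹ := by
      refine (measure_mono subset_closure).trans ?_
      rw [hμ, Measure.map_apply hfm isClosed_closure.measurableSet]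
      exact unifProd_preimage_le hb D hne hD m _ (by rwa [Metric.ediam_closure])
    have hpos : (0 : ℝ) < c * ((b : ℝ) ^ m) ^ (s : ℝ) := by positivity
    have h2 : (25 : ℝ≥0∞) * (((∏ i ∈ Finset.Icc 1 m, (D i).card : ℕ) : ℝ≥0∞))⁻¹ ≤
        ENNReal.ofReal (25 * (c * ((b : ℝ) ^ m) ^ (s : ℝ))⁻¹) := by
      rw [ENNReal.ofReal_mul (by norm_num), ENNReal.ofReal_inv_of_pos hpos]
      gcongr
      · norm_num
      · rw [← ENNReal.ofReal_natCast]
        exact ENNReal.ofReal_le_ofReal (hmass m)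
    refine (mul_le_mul_right (h1.trans h2) _).trans ?_
    rw [← ENNReal.ofReal_mul hκ0.le]
    refine ENNReal.ofReal_le_ofReal (le_of_eq ?_)
    rw [Real.inv_rpow (by positivity), pow_succ, Real.mul_rpow (by positivity) (by positivity), hκ]
    field_simp
  have hle : ENNReal.ofReal κ • μ ≤ μH[(s : ℝ)] := by
    refine Measure.le_hausdorffMeasure _ _ 1 one_pos fun A hA => ?_
    rw [Measure.smul_apply, smul_eq_mul]
    have hfin : Metric.ediam A ≠ ∞ := ne_top_of_le_ne_top ENNReal.one_ne_top hA
    rcases eq_or_ne (Metric.ediam A) 0 with h0 | h0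
    · refine le_trans ?_ zero_le
      have ht : Tendsto (fun m : ℕ => ENNReal.ofReal (((b : ℝ) ^ (m + 1))⁻¹ ^ (s : ℝ))) atTop
          (𝓝 0) := by
        rw [← ENNReal.ofReal_zero]
        refine ENNReal.tendsto_ofReal ?_
        have h1 : Tendsto (fun m : ℕ => ((b : ℝ) ^ (m + 1))⁻¹) atTop (𝓝 0) :=
          ((tendsto_pow_atTop_atTop_of_one_lt hb').comp (tendsto_add_atTop_nat 1)).inv_tendsto_atTop
        simpa [Real.zero_rpow hs'.ne'] using h1.rpow_const (p := (s : ℝ)) (Or.inr hs'.le)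
      exact ge_of_tendsto' ht fun m => key m A (by simp [h0])
    · set δ := (Metric.ediam A).toReal with hδ
      have hδ0 : 0 < δ := ENNReal.toReal_pos h0 hfin
      have hδ1 : δ ≤ 1 := by
        rw [hδ, ← ENNReal.toReal_one]
        exact ENNReal.toReal_mono ENNReal.one_ne_top hA
      have hδe : Metric.ediam A = ENNReal.ofReal δ := (ENNReal.ofReal_toReal hfin).symm
      obtain ⟨m, hm1, hm2⟩ := exists_nat_pow_near_of_lt_one hδ0 hδ1
        (y := (b : ℝ)⁻¹) (by positivity) (inv_lt_one_of_one_lt₀ hb')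
      rw [inv_pow] at hm1 hm2
      refine (key m A (hδe ▸ ENNReal.ofReal_le_ofReal hm2)).trans ?_
      rw [hδe, ENNReal.ofReal_rpow_of_nonneg hδ0.le hs'.le]
      exact ENNReal.ofReal_le_ofReal (Real.rpow_le_rpow (by positivity) hm1.le hs'.le)
  apply le_dimH_of_hausdorffMeasure_ne_zero
  intro hzero
  have h1 : (ENNReal.ofReal κ • μ) (point b '' {d | ∀ i, 1 ≤ i → d i ∈ D i}) ≤ 0 :=
    hzero ▸ hle _
  rw [Measure.smul_apply, smul_eq_mul, nonpos_iff_eq_zero, mul_eq_zero] at h1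
  rcases h1 with h1 | h1
  · exact absurd (ENNReal.ofReal_eq_zero.1 h1) (not_le.2 hκ0)
  · have h2 := Measure.le_map_apply hfm.aemeasurable (μ := unifProd D hne)
      (point b '' {d | ∀ i, 1 ≤ i → d i ∈ D i})
    rw [← hμ, h1, nonpos_iff_eq_zero, measure_eq_zero_iff_ae_notMem] at h2
    have h3 : ∀ᵐ _ ∂unifProd D hne, False := by
      filter_upwards [h2, ae_unifProd_mem D hne] with ω h4 h5
      refine h4 ⟨ω, fun i _ => h5 i, point_congr fun i hi => ?_⟩
      exact (clamp_eq_self (hD i hi (h5 i))).symm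
    rw [eventually_false_iff_eq_bot, ae_eq_bot] at h3
    exact IsProbabilityMeasure.ne_zero _ h3

/-- The sum of the logarithms of the cardinalities of the rows met by `u 1, …, u j`. -/
def rowSum (J : Finset (ℕ × ℕ)) (u : ℕ → ℕ) (j : ℕ) : ℝ :=
  ∑ i ∈ Finset.Icc 1 j, Real.log (J2 J (u i)).card

lemma rowSum_succ (J : Finset (ℕ × ℕ)) (u : ℕ → ℕ) (j : ℕ) :
    rowSum J u (j + 1) = rowSum J u j + Real.log (J2 J (u (j + 1))).card := by
  rw [rowSum, Finset.sum_Icc_succ_top (by omega), rowSum]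

lemma tendsto_rowSum_div (J : Finset (ℕ × ℕ)) {u : ℕ → ℕ} (hu : ∀ i, 1 ≤ i → u i < b) {p : ℕ → ℝ}
    (hp : ∀ a, a < b → Tendsto (fun n : ℕ => (freqCount u a n : ℝ) / n) atTop (𝓝 (p a))) :
    Tendsto (fun n : ℕ => rowSum J u n / n) atTop
      (𝓝 (∑ a ∈ Finset.range b, p a * Real.log ((J2 J a).card))) := by
  have h : ∀ n : ℕ, rowSum J u n / n =
      ∑ a ∈ Finset.range b, (freqCount u a n : ℝ) / n * Real.log ((J2 J a).card) := by
    intro n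
    rw [rowSum, ← Finset.sum_fiberwise_of_maps_to (t := Finset.range b) (g := u)
      (fun i hi => Finset.mem_range.2 (hu i (Finset.mem_Icc.1 hi).1)), Finset.sum_div]
    refine Finset.sum_congr rfl fun a _ => ?_
    rw [Finset.sum_congr rfl (g := fun _ => Real.log (J2 J a).card)
      fun i hi => by rw [(Finset.mem_filter.1 hi).2], Finset.sum_const, nsmul_eq_mul, freqCount]
    ring
  simp only [h]
  exact tendsto_finsetSum _ fun a ha => (hp a (Finset.mem_range.1 ha)).mul_const _

lemma eventually_abs_le_of_tendsto_div {S : ℕ → ℝ} {G : ℝ}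
    (h : Tendsto (fun n : ℕ => S n / n) atTop (𝓝 G)) {ε : ℝ} (hε : 0 < ε) :
    ∀ᶠ n : ℕ in atTop, |S n - n * G| ≤ ε * n := by
  filter_upwards [h.eventually (Metric.closedBall_mem_nhds G hε), eventually_gt_atTop 0] with n hn h0
  have h0' : (0 : ℝ) < n := by exact_mod_cast h0
  rw [Real.dist_eq] at hn
  have : S n - n * G = n * (S n / n - G) := by field_simp
  rw [this, abs_mul, abs_of_pos h0']
  nlinarith

/-- A digit of frequency different from `1` has no long constant runs. -/
lemma eventually_exists_ne {u : ℕ → ℕ} {a : ℕ} {p : ℝ}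
    (h : Tendsto (fun n : ℕ => (freqCount u a n : ℝ) / n) atTop (𝓝 p)) (hp : p ≠ 1) {δ : ℝ}
    (hδ : 0 < δ) :
    ∀ᶠ L : ℕ in atTop, ∀ q : ℕ, (q : ℝ) ≤ (1 - δ) * L → ∃ i, q < i ∧ i < L ∧ u i ≠ a := by
  have hle : ∀ n, (freqCount u a n : ℝ) ≤ n := fun n => by
    have : freqCount u a n ≤ n := (Finset.card_filter_le _ _).trans (by simp)
    exact_mod_cast this
  have hmono : ∀ q n, q ≤ n → (∀ i, q < i → i ≤ n → u i = a) →
      freqCount u a n = freqCount u a q + (n - q) := by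
    intro q n hqn hi
    induction n, hqn using Nat.le_induction with
    | base => simp
    | succ n hn ih =>
      have e : freqCount u a (n + 1) = freqCount u a n + 1 := by
        rw [freqCount, freqCount, Finset.card_filter, Finset.card_filter,
          Finset.sum_Icc_succ_top (by omega), if_pos (hi (n + 1) (by omega) le_rfl)]
      rw [e, ih fun i h1 h2 => hi i h1 (by omega)]
      omega
  have hp1 : p < 1 := lt_of_le_of_ne (le_of_tendsto' h fun n => div_le_one_of_le₀ (hle n)
    (Nat.cast_nonneg n)) hp
  have hε : 0 < (1 - p) * δ / 4 := by
    have : 0 < 1 - p := by linarith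
    positivity
  obtain ⟨M, hM⟩ := eventually_atTop.1 (eventually_abs_le_of_tendsto_div h hε)
  have hp0 : 0 ≤ p := ge_of_tendsto' h fun n => by positivity
  have hall : ∀ n : ℕ, |(freqCount u a n : ℝ) - n * p| ≤ (1 - p) * δ / 4 * n + M := by
    intro n
    have hn : (0 : ℝ) ≤ n := Nat.cast_nonneg n
    rcases le_total M n with hMn | hMn
    · exact (hM n hMn).trans (by simp)
    · have h1 : (n : ℝ) ≤ M := by exact_mod_cast hMn
      have h2 := hle n
      have h3 : (0 : ℝ) ≤ freqCount u a n := Nat.cast_nonneg _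
      have h4 := mul_nonneg hε.le hn
      rw [abs_le]
      constructor <;> nlinarith
  filter_upwards [eventually_gt_atTop ⌈(2 * M / (1 - p) + 1) * 2 / δ⌉₊,
    eventually_gt_atTop ⌈1 / δ⌉₊] with L hL hL1 q hq
  have hL' : (2 * M / (1 - p) + 1) * 2 / δ < L := lt_of_le_of_lt (Nat.le_ceil _)
    (by exact_mod_cast hL)
  have hL1' : 1 / δ < L := lt_of_le_of_lt (Nat.le_ceil _) (by exact_mod_cast hL1)
  rw [div_lt_iff₀ hδ] at hL' hL1'
  have hqL : q + 1 ≤ L := by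
    have : (q : ℝ) + 1 ≤ L := by nlinarith
    exact_mod_cast this
  by_contra! hcon
  have hfr := hmono q (L - 1) (by omega) fun i h1 h2 => hcon i h1 (by omega)
  obtain ⟨k, rfl⟩ : ∃ k, L = k + 1 := ⟨L - 1, by omega⟩
  have hk := abs_le.1 (hall k)
  have hq' := abs_le.1 (hall q)
  rw [Nat.add_sub_cancel] at hfr
  have hfr' : (freqCount u a k : ℝ) = freqCount u a q + (k - q) := by
    rw [hfr, Nat.cast_add, Nat.cast_sub (by omega)]
  push_cast at *
  have hp' : 0 < 1 - p := by linarith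
  have e : 2 * (M : ℝ) = 2 * M / (1 - p) * (1 - p) := by field_simp
  have hqk : (q : ℝ) ≤ k := by exact_mod_cast (by omega : q ≤ k)
  have key : (k - q : ℝ) * (1 - p) ≤ (1 - p) * δ / 4 * (k + q) + 2 * M := by linarith
  have k2 : (1 - p) * δ / 4 * (k + q) ≤ (1 - p) * δ / 4 * (2 * (k + 1)) :=
    mul_le_mul_of_nonneg_left (by linarith) hε.le
  have k3 : (δ * (k + 1) - 1) * (1 - p) ≤ (k - q : ℝ) * (1 - p) :=
    mul_le_mul_of_nonneg_right (by linarith) hp'.le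
  have k4 := mul_lt_mul_of_pos_right hL' hp'
  linarith

lemma eventually_digits_eq (hb : 2 ≤ b) {w : ℕ → ℕ} (hw : ∀ i, 1 ≤ i → w i < b) {p : ℕ → ℝ}
    (hp : ∀ a, a < b → Tendsto (fun n : ℕ => (freqCount w a n : ℝ) / n) atTop (𝓝 (p a)))
    (hp0 : p 0 ≠ 1) (hpb : p (b - 1) ≠ 1) {δ : ℝ} (hδ : 0 < δ) :
    ∀ᶠ L : ℕ in atTop, ∀ v : ℕ → ℕ, (∀ i, 1 ≤ i → v i < b) →
      |val b v - val b w| ≤ ((b : ℝ) ^ L)⁻¹ →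
      ∀ i : ℕ, 1 ≤ i → (i : ℝ) ≤ (1 - δ) * L → v i = w i := by
  filter_upwards [eventually_exists_ne (hp 0 (by omega)) hp0 hδ,
    eventually_exists_ne (hp (b - 1) (by omega)) hpb hδ] with L h0 hb1 v hv hvw i hi hiL
  by_contra hne
  classical
  have hex : ∃ i, 1 ≤ i ∧ v i ≠ w i := ⟨i, hi, hne⟩
  obtain ⟨hn1, hn2⟩ := Nat.find_spec hex
  have hni : Nat.find hex ≤ i := Nat.find_min' hex ⟨hi, hne⟩
  obtain ⟨k, hk⟩ : ∃ k, Nat.find hex = k + 1 := ⟨Nat.find hex - 1, by omega⟩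
  rw [hk] at hn2
  have hlt : ∀ j, 1 ≤ j → j ≤ k → v j = w j := by
    intro j h1 h2
    by_contra hc
    exact Nat.find_min hex (m := j) (by omega) ⟨h1, hc⟩
  have hkL : ((k + 1 : ℕ) : ℝ) ≤ (1 - δ) * L :=
    le_trans (by exact_mod_cast hk ▸ hni) hiL
  rw [abs_le] at hvw
  rcases lt_or_gt_of_ne hn2 with hc | hc
  · obtain ⟨j, h1, h2, h3⟩ := h0 (k + 1) hkL
    exact h3 (digits_zero_of_val_close hb hv hw hlt hc (by linarith) j h1 h2)
  · obtain ⟨j, h1, h2, h3⟩ := hb1 (k + 1) hkL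
    exact h3 (digits_max_of_val_close hb hv hw hlt hc (by linarith) j h1 h2)

lemma prod_range_succ_eq_prod_Icc {M : Type*} [CommMonoid M] (f : ℕ → M) (k : ℕ) :
    ∏ x ∈ Finset.range k, f (x + 1) = ∏ i ∈ Finset.Icc 1 k, f i := by
  induction k with
  | zero => simp
  | succ k ih => rw [Finset.prod_range_succ, ih, Finset.prod_Icc_succ_top (by omega)]

lemma sum_Icc_ite_lt (f : ℕ → ℝ) {l k : ℕ} (h : l ≤ k) :
    ∑ i ∈ Finset.Icc 1 k, (if l < i then f i else 0) =
      ∑ i ∈ Finset.Icc 1 k, f i - ∑ i ∈ Finset.Icc 1 l, f i := by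
  induction k, h using Nat.le_induction with
  | base =>
    rw [sub_self]
    exact Finset.sum_eq_zero fun i hi => if_neg (by have := Finset.mem_Icc.1 hi; omega)
  | succ k hk ih =>
    rw [Finset.sum_Icc_succ_top (by omega), Finset.sum_Icc_succ_top (by omega), ih,
      if_pos (by omega)]
    ring

lemma abs_val_sub_eq_of_shift (hb : 2 ≤ b) {u v : ℕ → ℕ} (hu : ∀ i, 1 ≤ i → u i < b)
    (hv : ∀ i, 1 ≤ i → v i < b) {m : ℕ} (h : ∀ i, 1 ≤ i → i ≤ m → u i = v i) :
    |val b u - val b v| =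
      ((b : ℝ) ^ m)⁻¹ * |val b (fun i => u (i + m)) - val b (fun i => v (i + m))| := by
  have hpos : (0 : ℝ) < (b : ℝ) ^ m := by positivity
  have h1 := pow_mul_val hb hu m
  have h2 := pow_mul_val hb hv m
  rw [pre_congr h] at h1
  rw [eq_inv_mul_iff_mul_eq₀ hpos.ne', ← abs_of_pos hpos, ← abs_mul]
  congr 1
  linarith

lemma exists_cover_hitSet_fst (hb : 2 ≤ b) {J : Finset (ℕ × ℕ)}
    (hJ : J ⊆ Finset.range b ×ˢ Finset.range b) (lam xi : ℕ → ℕ) (z w : ℝ) (n : ℕ)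
    (hle : lam n ≤ xi n) :
    ∃ t : Fin (J.card ^ n) → Set (ℝ × ℝ), hitSet b J lam xi z w n ⊆ ⋃ i, t i ∧
      ∀ i, Metric.ediam (t i) ≤ ENNReal.ofReal (2 * ((b : ℝ) ^ (n + lam n))⁻¹) := by
  have hcard : (Fintype.piFinset fun _ : Fin n => J).card = J.card ^ n := by simp
  rw [← hcard]
  refine exists_cover_of_code (point b) _ (fun d (i : Fin n) => d (i + 1)) _ ?_ ?_
  · rintro d ⟨hd, -⟩
    exact Fintype.mem_piFinset.2 fun i => hd _ (by omega)
  · rintro d ⟨hd, hdz, hdw⟩ e ⟨he, hez, hew⟩ hde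
    have hag : ∀ i, 1 ≤ i → i ≤ n → d i = e i := by
      intro i h1 h2
      have := congrFun hde ⟨i - 1, by omega⟩
      simpa [Nat.sub_add_cancel h1] using this
    have hb1 : (1 : ℝ) ≤ b := by exact_mod_cast (by omega : 1 ≤ b)
    have hpow : ((b : ℝ) ^ xi n)⁻¹ ≤ ((b : ℝ) ^ lam n)⁻¹ :=
      inv_anti₀ (by positivity) (pow_le_pow_right₀ hb1 hle)
    have hposn : (0 : ℝ) < ((b : ℝ) ^ n)⁻¹ := by positivity
    have h2 : 2 * ((b : ℝ) ^ (n + lam n))⁻¹ = ((b : ℝ) ^ n)⁻¹ * (2 * ((b : ℝ) ^ lam n)⁻¹) := by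
      rw [pow_add, mul_inv]; ring
    rw [Prod.dist_eq, h2]
    simp only [point]
    rw [Real.dist_eq, Real.dist_eq,
      abs_val_sub_eq_of_shift hb (fst_lt_of_mem hJ hd) (fst_lt_of_mem hJ he) (m := n)
        (fun i h1 h2 => by rw [hag i h1 h2]),
      abs_val_sub_eq_of_shift hb (snd_lt_of_mem hJ hd) (snd_lt_of_mem hJ he) (m := n)
        (fun i h1 h2 => by rw [hag i h1 h2])]
    rw [abs_le] at hdz hdw hez hew
    refine max_le (mul_le_mul_of_nonneg_left ?_ hposn.le)
      (mul_le_mul_of_nonneg_left ?_ hposn.le) <;>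
      rw [abs_le] <;> constructor <;> linarith

/-- The digit choices allowed at position `i` after a hit of the target `d₀`, when the first `m`
digits are prescribed and the first `q` rows are those of `d₀`. -/
def rowChoice (J : Finset (ℕ × ℕ)) (d₀ : ℕ → ℕ × ℕ) (m q i : ℕ) : Finset (ℕ × ℕ) :=
  if i ≤ m then {(0, 0)} else if i ≤ q then J2 J (d₀ i).2 else J

lemma exists_cover_hitSet_snd (hb : 2 ≤ b) {J : Finset (ℕ × ℕ)}
    (hJ : J ⊆ Finset.range b ×ˢ Finset.range b) (lam xi : ℕ → ℕ) {z w : ℝ}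
    {d₀ : ℕ → ℕ × ℕ} (hd₀ : ∀ i, 1 ≤ i → d₀ i ∈ J) (hz : val b (fun i => (d₀ i).1) = z)
    (n : ℕ) {m q : ℕ} (hml : m ≤ lam n) (hmq : m ≤ q)
    (hq : ∀ v : ℕ → ℕ, (∀ i, 1 ≤ i → v i < b) → |val b v - w| ≤ ((b : ℝ) ^ xi n)⁻¹ →
      ∀ i, 1 ≤ i → i ≤ q → v i = (d₀ i).2) :
    ∃ t : Fin (5 * (J.card ^ n * ∏ i ∈ Finset.Icc 1 (xi n), (rowChoice J d₀ m q i).card)) →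
      Set (ℝ × ℝ), hitSet b J lam xi z w n ⊆ ⋃ i, t i ∧
      ∀ i, Metric.ediam (t i) ≤ ENNReal.ofReal (((b : ℝ) ^ (n + xi n))⁻¹) := by
  obtain ⟨K, hK⟩ : ∃ K : ℤ, K = (pre b (fun i => (d₀ i).1) m : ℕ) := ⟨_, rfl⟩
  set S : ℕ → Finset (ℕ × ℕ) := fun i => if i < n then J else rowChoice J d₀ m q (i + 1 - n)
    with hS
  have hcard : (Finset.Icc (K - 2) (K + 2) ×ˢ
      Fintype.piFinset fun i : Fin (n + xi n) => S i).card =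
      5 * (J.card ^ n * ∏ i ∈ Finset.Icc 1 (xi n), (rowChoice J d₀ m q i).card) := by
    rw [Finset.card_product, Int.card_Icc, Fintype.card_piFinset,
      Fin.prod_univ_eq_prod_range (fun i => (S i).card) (n + xi n), Finset.prod_range_add,
      ← prod_range_succ_eq_prod_Icc]
    congr 1
    · have : K + 2 + 1 - (K - 2) = 5 := by ring
      rw [this]; rfl
    · congr 1
      · rw [Finset.prod_congr rfl (g := fun _ => J.card) fun i hi => by
          simp [hS, Finset.mem_range.1 hi]]
        simp
      · refine Finset.prod_congr rfl fun i _ => ?_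
        have e : n + i + 1 - n = i + 1 := by omega
        simp only [hS, if_neg (show ¬ n + i < n by omega), e]
  rw [← hcard]
  have hb1 : (1 : ℝ) ≤ b := by exact_mod_cast (by omega : 1 ≤ b)
  have hpow : ((b : ℝ) ^ lam n)⁻¹ ≤ ((b : ℝ) ^ m)⁻¹ :=
    inv_anti₀ (by positivity) (pow_le_pow_right₀ hb1 hml)
  refine exists_cover_of_code (point b) _ (fun d => ((pre b (fun i => (d (i + n)).1) m : ℤ),
    fun i : Fin (n + xi n) => if n ≤ (i : ℕ) ∧ (i : ℕ) < n + m then (0, 0) else d (i + 1))) _ ?_ ?_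
  · rintro d ⟨hd, hdz, hdw⟩
    rw [Finset.mem_product]
    constructor
    · have := abs_pre_sub_le hb (u := fun i => (d (i + n)).1) (v := fun i => (d₀ i).1) (m := m)
        (fun i hi => fst_lt_of_mem hJ hd _ (by omega)) (fst_lt_of_mem hJ hd₀)
        (by rw [hz]; exact hdz.trans hpow)
      rw [← hK, abs_le] at this
      simp only [Finset.mem_Icc]
      omega
    · refine Fintype.mem_piFinset.2 fun i => ?_
      simp only [hS, rowChoice]
      by_cases h1 : (i : ℕ) < n
      · rw [if_pos h1, if_neg (by omega)]
        exact hd _ (by omega)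
      · rw [if_neg h1]
        by_cases h2 : (i : ℕ) < n + m
        · rw [if_pos (by omega : (i : ℕ) + 1 - n ≤ m), if_pos ⟨by omega, h2⟩]
          simp
        · rw [if_neg (by omega : ¬ (i : ℕ) + 1 - n ≤ m),
            if_neg (by omega : ¬ (n ≤ (i : ℕ) ∧ (i : ℕ) < n + m))]
          split_ifs with h3
          · rw [J2, Finset.mem_filter]
            refine ⟨hd _ (by omega), ?_⟩
            have := hq (fun i => (d (i + n)).2) (fun i hi => snd_lt_of_mem hJ hd _ (by omega))
              hdw (i + 1 - n) (by omega) h3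
            rw [← this]
            congr 2
            omega
          · exact hd _ (by omega)
  · rintro d ⟨hd, hdz, hdw⟩ e ⟨he, hez, hew⟩ hde
    obtain ⟨hp, hc⟩ := Prod.mk.inj hde
    have hx := digits_eq_of_pre_eq (u := fun i => (d (i + n)).1) (v := fun i => (e (i + n)).1)
      (fun i hi => fst_lt_of_mem hJ hd _ (by omega))
      (fun i hi => fst_lt_of_mem hJ he _ (by omega)) (m := m) (by exact_mod_cast hp)
    have hdy := hq (fun i => (d (i + n)).2) (fun i hi => snd_lt_of_mem hJ hd _ (by omega)) hdw
    have hey := hq (fun i => (e (i + n)).2) (fun i hi => snd_lt_of_mem hJ he _ (by omega)) hew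
    have hag : ∀ i, 1 ≤ i → i ≤ n + xi n → d i = e i := by
      intro i h1 h2
      by_cases h3 : n < i ∧ i ≤ n + m
      · obtain ⟨j, rfl⟩ : ∃ j, i = j + n := ⟨i - n, by omega⟩
        exact Prod.ext (hx j (by omega) (by omega))
          ((hdy j (by omega) (by omega)).trans (hey j (by omega) (by omega)).symm)
      · have := congrFun hc ⟨i - 1, by omega⟩
        simp only at this
        rwa [if_neg (by omega), if_neg (by omega), Nat.sub_add_cancel h1] at this
    rw [Prod.dist_eq]
    exact max_le
      (abs_val_sub_le hb (fst_lt_of_mem hJ hd) (fst_lt_of_mem hJ he)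
        fun i h1 h2 => by rw [hag i h1 h2])
      (abs_val_sub_le hb (snd_lt_of_mem hJ hd) (snd_lt_of_mem hJ he)
        fun i h1 h2 => by rw [hag i h1 h2])

lemma prod_rowChoice_card_le {J : Finset (ℕ × ℕ)} (hJne : J.Nonempty) (d₀ : ℕ → ℕ × ℕ)
    {l k q : ℕ} (hlk : l ≤ k) (hqk : q ≤ k) :
    ((∏ i ∈ Finset.Icc 1 k, (rowChoice J d₀ (min l q) q i).card : ℕ) : ℝ) ≤
      Real.exp (rowSum J (fun i => (d₀ i).2) k - rowSum J (fun i => (d₀ i).2) l +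
        (k - q) * Real.log J.card) := by
  have hJ0 : (0 : ℝ) < J.card := by exact_mod_cast hJne.card_pos
  have hc : ((k : ℝ) - q) * Real.log J.card =
      ∑ i ∈ Finset.Icc 1 k, (if q < i then Real.log J.card else 0) := by
    rw [sum_Icc_ite_lt _ hqk]
    simp
    ring
  rw [rowSum, rowSum, ← sum_Icc_ite_lt _ hlk, hc, ← Finset.sum_add_distrib, Real.exp_sum]
  push_cast
  refine Finset.prod_le_prod (fun i _ => Nat.cast_nonneg _) fun i _ => ?_
  have hΓ : 0 ≤ Real.log J.card := Real.log_natCast_nonneg _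
  have hg : 0 ≤ Real.log (J2 J (d₀ i).2).card := Real.log_natCast_nonneg _
  rw [rowChoice]
  by_cases h1 : i ≤ min l q
  · rw [if_pos h1, Finset.card_singleton, Nat.cast_one]
    refine Real.one_le_exp (add_nonneg ?_ ?_) <;> split_ifs <;> first | assumption | exact le_rfl
  rw [if_neg h1]
  by_cases h2 : i ≤ q
  · rw [if_pos h2, if_pos (by omega), if_neg (by omega), add_zero]
    exact Real.le_exp_log _
  · rw [if_neg h2, if_pos (by omega : q < i)]
    refine (Real.exp_log hJ0).ge.trans (Real.exp_le_exp.2 ?_)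
    split_ifs <;> linarith

lemma inv_pow_rpow_eq_exp (hb : 2 ≤ b) (N : ℕ) (s : ℝ) :
    (((b : ℝ) ^ N)⁻¹) ^ s = Real.exp (-(s * Real.log b * N)) := by
  rw [Real.rpow_def_of_pos (by positivity), Real.log_inv, Real.log_pow]
  congr 1
  ring

lemma inv_pow_add_le_half_pow (hb : 2 ≤ b) (n k : ℕ) :
    ((b : ℝ) ^ (n + k))⁻¹ ≤ (1 / 2) ^ n := by
  have hb' : (2 : ℝ) ≤ b := by exact_mod_cast hb
  rw [one_div, inv_pow]
  exact inv_anti₀ (by positivity)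
    ((pow_le_pow_left₀ (by norm_num) hb' n).trans
      (pow_le_pow_right₀ (by linarith) (Nat.le_add_right n k)))

/-- Upper bound for the dimension: it suffices that one of the two natural covers of each
`hitSet` is efficient at exponents slightly below `s`. -/
lemma dimH_limsup_hitSet_le (hb : 2 ≤ b) {J : Finset (ℕ × ℕ)}
    (hJ : J ⊆ Finset.range b ×ˢ Finset.range b) (hJ2 : 2 ≤ J.card) {lam xi : ℕ → ℕ}
    (hle : ∀ n, lam n ≤ xi n) (hlam : Tendsto lam atTop atTop) {z w : ℝ}
    {d₀ : ℕ → ℕ × ℕ} (hd₀ : ∀ i, 1 ≤ i → d₀ i ∈ J) (hz : val b (fun i => (d₀ i).1) = z)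
    {G : ℝ}
    (hG : Tendsto (fun n : ℕ => rowSum J (fun i => (d₀ i).2) n / n) atTop (𝓝 G))
    (hdig : ∀ δ : ℝ, 0 < δ → ∀ᶠ L : ℕ in atTop, ∀ v : ℕ → ℕ, (∀ i, 1 ≤ i → v i < b) →
      |val b v - w| ≤ ((b : ℝ) ^ L)⁻¹ →
      ∀ i : ℕ, 1 ≤ i → (i : ℝ) ≤ (1 - δ) * L → v i = (d₀ i).2)
    (s : ℝ≥0) {η : ℝ} (hη : 0 < η)
    (hF : ∀ᶠ n : ℕ in atTop, n * Real.log J.card < (s - η) * Real.log b * (n + lam n) ∨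
      n * Real.log J.card + (xi n - lam n) * G < (s - η) * Real.log b * (n + xi n)) :
    dimH {p | ∃ᶠ n in atTop, p ∈ hitSet b J lam xi z w n} ≤ s := by
  have hℓ : 0 < Real.log b := Real.log_pos (by exact_mod_cast hb)
  have hJ1 : (1 : ℝ) < J.card := by exact_mod_cast hJ2
  have hΓ : 0 < Real.log J.card := Real.log_pos hJ1
  have hxi : Tendsto xi atTop atTop := tendsto_atTop_mono hle hlam
  set ℓ := Real.log b with hℓd
  set Γ := Real.log J.card with hΓd
  set S := rowSum J (fun i => (d₀ i).2) with hS
  set δ := η * ℓ / (2 * Γ) with hδd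
  have hδ : 0 < δ := by positivity
  have hδΓ : δ * Γ = η * ℓ / 2 := by rw [hδd]; field_simp
  have hε : 0 < η * ℓ / 4 := by positivity
  have hSe := eventually_abs_le_of_tendsto_div hG hε
  have hpowJ : ∀ n : ℕ, ((J.card : ℝ)) ^ n = Real.exp (n * Γ) := fun n => by
    rw [mul_comm, Real.exp_mul, Real.exp_log (by linarith), Real.rpow_natCast]
  refine dimH_limsup_le _ s 2 (fun n => (2 ^ (s : ℝ) + 5 * Real.exp Γ) * Real.exp (-(η * ℓ)) ^ n)
    ?_ ?_
  · exact (summable_geometric_of_lt_one (Real.exp_pos _).le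
      (Real.exp_lt_one_iff.2 (by nlinarith [mul_pos hη hℓ]))).mul_left _
  have h2s : (0 : ℝ) < 2 ^ (s : ℝ) := by positivity
  filter_upwards [hF, hxi.eventually (hdig δ hδ), hxi.eventually hSe, hlam.eventually hSe]
    with n hn hdn hSx hSl
  have hn0 : (0 : ℝ) ≤ n := Nat.cast_nonneg n
  have hl0 : (0 : ℝ) ≤ lam n := Nat.cast_nonneg _
  have hlx : (lam n : ℝ) ≤ xi n := by exact_mod_cast hle n
  have hηℓ : 0 < η * ℓ := by positivity
  have hexp : Real.exp (-(η * ℓ)) ^ n = Real.exp (-(η * ℓ) * n) := by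
    rw [← Real.exp_nat_mul, mul_comm]
  rcases hn with hn | hn
  · refine ⟨J.card ^ n, 2 * ((b : ℝ) ^ (n + lam n))⁻¹, by positivity,
      mul_le_mul_of_nonneg_left (inv_pow_add_le_half_pow hb _ _) (by norm_num), ?_,
      exists_cover_hitSet_fst hb hJ lam xi z w n (hle n)⟩
    rw [Real.mul_rpow (by norm_num) (by positivity), inv_pow_rpow_eq_exp hb, Nat.cast_pow, hpowJ,
      hexp]
    have : Real.exp (n * Γ) * Real.exp (-((s : ℝ) * Real.log b * (n + lam n : ℕ))) ≤
        Real.exp (-(η * ℓ) * n) := by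
      rw [← Real.exp_add, Real.exp_le_exp]
      push_cast
      nlinarith [mul_nonneg hηℓ.le hl0]
    calc _ = 2 ^ (s : ℝ) * (Real.exp (n * Γ) *
          Real.exp (-((s : ℝ) * Real.log b * (n + lam n : ℕ)))) := by ring
      _ ≤ 2 ^ (s : ℝ) * Real.exp (-(η * ℓ) * n) := mul_le_mul_of_nonneg_left this h2s.le
      _ ≤ _ := mul_le_mul_of_nonneg_right (by linarith [Real.exp_pos Γ]) (Real.exp_pos _).le
  · set q := ⌊(1 - δ) * xi n⌋₊ with hq
    have hx0 : (0 : ℝ) ≤ xi n := Nat.cast_nonneg _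
    have hqx : q ≤ xi n := by
      rw [hq, ← Nat.floor_natCast (R := ℝ) (xi n)]
      refine Nat.floor_le_floor ?_
      rw [Nat.floor_natCast]
      nlinarith
    have hqx' : (xi n : ℝ) - q ≤ δ * xi n + 1 := by
      have := Nat.lt_floor_add_one ((1 - δ) * xi n)
      rw [← hq] at this
      linarith
    refine ⟨_, _, by positivity, ?_, ?_, exists_cover_hitSet_snd hb hJ lam xi hd₀ hz n
      (min_le_left (lam n) q) (min_le_right _ _) fun v hv hvw i h1 h2 => hdn v hv hvw i h1
        ((Nat.le_floor_iff' (by omega)).1 h2)⟩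
    · exact (inv_pow_add_le_half_pow hb _ _).trans (by
        have : (0 : ℝ) < (1 / 2) ^ n := by positivity
        linarith)
    · have hP := prod_rowChoice_card_le (J := J) (Finset.card_pos.1 (by omega)) d₀ (hle n) hqx
      rw [inv_pow_rpow_eq_exp hb, Nat.cast_mul, Nat.cast_mul, Nat.cast_pow, hpowJ, hexp]
      rw [← hS, ← hΓd] at hP
      rw [abs_le] at hSx hSl
      have key : Real.exp (n * Γ) * Real.exp (S (xi n) - S (lam n) + (xi n - q) * Γ) *
          Real.exp (-((s : ℝ) * Real.log b * (n + xi n : ℕ))) ≤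
          Real.exp Γ * Real.exp (-(η * ℓ) * n) := by
        rw [← Real.exp_add, ← Real.exp_add, ← Real.exp_add, Real.exp_le_exp]
        push_cast
        have h1 := mul_le_mul_of_nonneg_right hqx' hΓ.le
        have h2 : η * ℓ / 4 * lam n ≤ η * ℓ / 4 * xi n := mul_le_mul_of_nonneg_left hlx hε.le
        have h3 : δ * xi n * Γ = η * ℓ / 2 * xi n := by rw [← hδΓ]; ring
        nlinarith
      have h5 : (0 : ℝ) ≤ 5 := by norm_num
      calc _ ≤ ((5 : ℕ) : ℝ) * (Real.exp (n * Γ) *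
            Real.exp (S (xi n) - S (lam n) + (xi n - q) * Γ)) *
            Real.exp (-((s : ℝ) * Real.log b * (n + xi n : ℕ))) := by gcongr
        _ = 5 * (Real.exp (n * Γ) * Real.exp (S (xi n) - S (lam n) + (xi n - q) * Γ) *
            Real.exp (-((s : ℝ) * Real.log b * (n + xi n : ℕ)))) := by push_cast; ring
        _ ≤ 5 * (Real.exp Γ * Real.exp (-(η * ℓ) * n)) := mul_le_mul_of_nonneg_left key h5
        _ = 5 * Real.exp Γ * Real.exp (-(η * ℓ) * n) := by ring
        _ ≤ _ := mul_le_mul_of_nonneg_right (by linarith) (Real.exp_pos _).le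

lemma exists_enum_frequently {α : Type*} (J : Finset α) (hJ : J.Nonempty) :
    ∃ e : ℕ → α, (∀ k, e k ∈ J) ∧ ∀ a ∈ J, ∃ᶠ k in atTop, e k = a := by
  have hc := hJ.card_pos
  refine ⟨fun k => J.equivFin.symm ⟨k % J.card, Nat.mod_lt _ hc⟩, fun k => Subtype.coe_prop _,
    fun a ha => ?_⟩
  refine (Nat.frequently_mod_eq (J.equivFin ⟨a, ha⟩).isLt).mono fun k hk => ?_
  simp [hk]

lemma exists_sparse_seq {P : ℕ → Prop} (hP : ∃ᶠ n in atTop, P n) (g : ℕ → ℕ) :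
    ∃ N : ℕ → ℕ, (∀ k, P (N k)) ∧ ∀ k, g (N k) ≤ N (k + 1) := by
  choose f hf1 hf2 using frequently_atTop.1 hP
  exact ⟨fun k => Nat.rec (f 0) (fun _ n => f (g n)) k,
    fun k => by cases k <;> exact hf2 _, fun k => hf1 _⟩

/-- The digits allowed at position `j` after the start of a prescribed hit of the target. -/
def blockChoice (J : Finset (ℕ × ℕ)) (d₀ : ℕ → ℕ × ℕ) (l x : ℕ) (e : ℕ × ℕ) (j : ℕ) :
    Finset (ℕ × ℕ) :=
  if j ≤ l then {d₀ j} else if j ≤ x then J2 J (d₀ j).2 else {e}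

lemma mem_J2_self {J : Finset (ℕ × ℕ)} {a : ℕ × ℕ} (ha : a ∈ J) : a ∈ J2 J a.2 :=
  Finset.mem_filter.2 ⟨ha, rfl⟩

lemma blockChoice_nonempty {J : Finset (ℕ × ℕ)} {d₀ : ℕ → ℕ × ℕ} (hd₀ : ∀ i, 1 ≤ i → d₀ i ∈ J)
    (l x : ℕ) (e : ℕ × ℕ) {j : ℕ} (hj : 1 ≤ j) : (blockChoice J d₀ l x e j).Nonempty := by
  rw [blockChoice]
  split_ifs
  · exact Finset.singleton_nonempty _
  · exact ⟨_, mem_J2_self (hd₀ j hj)⟩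
  · exact Finset.singleton_nonempty _

lemma blockChoice_subset {J : Finset (ℕ × ℕ)} {d₀ : ℕ → ℕ × ℕ} (hd₀ : ∀ i, 1 ≤ i → d₀ i ∈ J)
    (l x : ℕ) {e : ℕ × ℕ} (he : e ∈ J) {j : ℕ} (hj : 1 ≤ j) : blockChoice J d₀ l x e j ⊆ J := by
  rw [blockChoice]
  split_ifs
  · exact Finset.singleton_subset_iff.2 (hd₀ j hj)
  · exact Finset.filter_subset _ _
  · exact Finset.singleton_subset_iff.2 he

/-- Digit sets which are free outside a sparse sequence of blocks, each block being a hit of the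
target, with products of cardinalities growing at rate `exp σ`. -/
lemma exists_digit_sets {J : Finset (ℕ × ℕ)} (hJ : J.Nonempty) {d₀ : ℕ → ℕ × ℕ}
    (hd₀ : ∀ i, 1 ≤ i → d₀ i ∈ J) {lam xi : ℕ → ℕ}
    (hle : ∀ n, lam n ≤ xi n) {σ : ℝ} (hσ0 : 0 ≤ σ)
    (hσ : σ ≤ Real.log J.card) {K : ℕ} (hK : 1 ≤ K)
    (hgood : ∃ᶠ n : ℕ in atTop, ∀ j ≤ xi n, σ * (n + j) ≤
      n * (Real.log J.card * (1 - 1 / K)) +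
        (rowSum J (fun i => (d₀ i).2) (max j (lam n)) -
          rowSum J (fun i => (d₀ i).2) (lam n))) :
    ∃ D : ℕ → Finset (ℕ × ℕ), (∀ i, (D i).Nonempty) ∧ (∀ i, D i ⊆ J) ∧
      (∀ m : ℕ, σ * m - σ ≤ ∑ i ∈ Finset.Icc 1 m, Real.log (D i).card) ∧
      (∀ a ∈ J, ∃ᶠ i in atTop, D i = {a}) ∧
      ∃ᶠ n in atTop, (∀ j, 1 ≤ j → j ≤ lam n → D (n + j) = {d₀ j}) ∧
        ∀ j, 1 ≤ j → j ≤ xi n → D (n + j) ⊆ J2 J (d₀ j).2 := by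
  classical
  obtain ⟨e, heJ, hef⟩ := exists_enum_frequently J hJ
  obtain ⟨N, hN, hNs⟩ := exists_sparse_seq hgood fun n => K * (n + xi n + 2)
  have hstep : ∀ k, N k + xi (N k) + 2 ≤ N (k + 1) := fun k =>
    (Nat.le_mul_of_pos_left _ hK).trans (hNs k)
  have hmono : StrictMono N := strictMono_nat_of_lt_succ fun k => by have := hstep k; omega
  set I : ℕ → ℕ → Prop := fun i k => N k < i ∧ i ≤ N k + xi (N k) + 1 with hI
  have huniq : ∀ i k k', I i k → I i k' → k = k' := by
    have : ∀ i k k', I i k → I i k' → ¬ k < k' := by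
      rintro i k k' ⟨h1, h2⟩ ⟨h3, h4⟩ hlt
      have h5 := hmono.monotone (Nat.succ_le_of_lt hlt)
      have h6 := hstep k
      simp only [Nat.succ_eq_add_one] at h5
      omega
    intro i k k' h h'
    exact le_antisymm (not_lt.1 (this i k' k h' h)) (not_lt.1 (this i k k' h h'))
  set B : ℕ → ℕ → Finset (ℕ × ℕ) := fun k j => blockChoice J d₀ (lam (N k)) (xi (N k)) (e k) j
    with hB
  set D : ℕ → Finset (ℕ × ℕ) := fun i =>
    if h : ∃ k, I i k then B h.choose (i - N h.choose) else J with hD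
  have hDin : ∀ i k, I i k → D i = B k (i - N k) := by
    intro i k h
    have hex : ∃ k, I i k := ⟨k, h⟩
    simp only [hD, dif_pos hex]
    rw [huniq i _ _ hex.choose_spec h]
  have hDout : ∀ i, (∀ k, ¬ I i k) → D i = J := by
    intro i h
    simp only [hD, dif_neg (not_exists.2 h)]
  have hDne : ∀ i, (D i).Nonempty := by
    intro i
    by_cases h : ∃ k, I i k
    · obtain ⟨k, hk⟩ := h
      rw [hDin i k hk]
      exact blockChoice_nonempty hd₀ _ _ _ (by have := hk.1; omega)
    · rwa [hDout i (not_exists.1 h)]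
  have hDJ : ∀ i, D i ⊆ J := by
    intro i
    by_cases h : ∃ k, I i k
    · obtain ⟨k, hk⟩ := h
      rw [hDin i k hk]
      exact blockChoice_subset hd₀ _ _ (heJ k) (by have := hk.1; omega)
    · rw [hDout i (not_exists.1 h)]
  refine ⟨D, hDne, hDJ, ?_, ?_, ?_⟩
  · set Γ := Real.log J.card with hΓ
    set S := rowSum J (fun i => (d₀ i).2) with hS
    set M : ℕ → ℝ := fun m => ∑ i ∈ Finset.Icc 1 m, Real.log (D i).card with hM
    have hMs : ∀ m, M (m + 1) = M m + Real.log (D (m + 1)).card := fun m => by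
      simp only [hM]
      rw [Finset.sum_Icc_succ_top (by omega)]
    have hlog0 : ∀ i, 0 ≤ Real.log (D i).card := fun i => Real.log_natCast_nonneg _
    have hM0 : ∀ m, 0 ≤ M m := fun m => Finset.sum_nonneg fun i _ => hlog0 i
    have hblock : ∀ k j, j ≤ xi (N k) →
        M (N k) + (S (max j (lam (N k))) - S (lam (N k))) ≤ M (N k + j) := by
      intro k j
      induction j with
      | zero => intro _; simp
      | succ j ih =>
        intro hj
        have ih' := ih (by omega)
        rw [← add_assoc, hMs, add_assoc, hDin (N k + (j + 1)) k ⟨by omega, by omega⟩,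
          Nat.add_sub_cancel_left]
        by_cases hl : j + 1 ≤ lam (N k)
        · rw [max_eq_right hl]
          rw [max_eq_right (by omega)] at ih'
          have : 0 ≤ Real.log (B k (j + 1)).card := Real.log_natCast_nonneg _
          linarith
        · rw [max_eq_left (by omega)]
          rw [max_eq_left (by omega)] at ih'
          have : B k (j + 1) = J2 J (d₀ (j + 1)).2 := by
            simp only [hB, blockChoice]
            rw [if_neg hl, if_pos hj]
          rw [this, hS, rowSum_succ, ← hS]
          linarith
    have hfree : ∀ k m, N k + xi (N k) + 1 ≤ m → m ≤ N (k + 1) →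
        M m = M (N k + xi (N k) + 1) + Γ * (m - (N k + xi (N k) + 1 : ℕ)) := by
      intro k m hm
      induction m, hm using Nat.le_induction with
      | base => intro _; simp
      | succ m hm ih =>
        intro hm'
        rw [hMs, ih (by omega), hDout (m + 1)]
        · push_cast
          ring
        · rintro k' ⟨h1, h2⟩
          have h3 : k' < k + 1 := hmono.lt_iff_lt.1 (h1.trans_le hm')
          have h4 : N k' + xi (N k') ≤ N k + xi (N k) := by
            rcases Nat.lt_succ_iff_lt_or_eq.1 h3 with h | rfl
            · have := hmono.monotone (Nat.succ_le_of_lt h)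
              have := hstep k'
              simp only [Nat.succ_eq_add_one] at *
              omega
            · exact le_rfl
          omega
    have hinit : ∀ m, m ≤ N 0 → M m = Γ * m := by
      intro m
      induction m with
      | zero => intro _; simp [hM]
      | succ m ih =>
        intro hm
        rw [hMs, ih (by omega), hDout (m + 1)]
        · push_cast
          ring
        · rintro k' ⟨h1, h2⟩
          have := hmono.monotone (Nat.zero_le k')
          omega
    have hΓ0 : 0 ≤ Γ := Real.log_natCast_nonneg _
    have hK0 : (0 : ℝ) < K := by exact_mod_cast hK
    have hstart : ∀ k, N k * (Γ * (1 - 1 / K)) ≤ M (N k) := by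
      intro k
      have hcalc : ∀ n : ℝ, n * (Γ * (1 - 1 / K)) = Γ * (n - n / K) := fun n => by ring
      rw [hcalc]
      cases k with
      | zero =>
        rw [hinit _ le_rfl]
        refine mul_le_mul_of_nonneg_left ?_ hΓ0
        have : (0 : ℝ) ≤ N 0 / K := by positivity
        linarith
      | succ k =>
        rw [hfree k (N (k + 1)) (by have := hstep k; omega) le_rfl]
        have h1 : ((N k + xi (N k) + 1 : ℕ) : ℝ) ≤ N (k + 1) / K := by
          rw [le_div_iff₀ hK0]
          have : (N k + xi (N k) + 1) * K ≤ N (k + 1) :=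
            le_trans (by rw [mul_comm]; exact Nat.mul_le_mul_left _ (by omega)) (hNs k)
          exact_mod_cast this
        have h2 := mul_le_mul_of_nonneg_left h1 hΓ0
        have h3 := hM0 (N k + xi (N k) + 1)
        linarith
    have hin : ∀ k j, j ≤ xi (N k) → σ * (N k + j) ≤ M (N k + j) := fun k j hj =>
      ((hN k j hj).trans (by have := hstart k; linarith)).trans (hblock k j hj)
    have hind : ∀ k m, m ≤ N k → σ * m - σ ≤ M m := by
      intro k
      induction k with
      | zero =>
        intro m hm
        rw [hinit m hm]
        have := mul_le_mul_of_nonneg_right hσ (Nat.cast_nonneg (α := ℝ) m)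
        linarith
      | succ k ih =>
        intro m hm
        rcases le_or_gt m (N k) with h | h
        · exact ih m h
        · rcases le_or_gt m (N k + xi (N k)) with h' | h'
          · obtain ⟨j, rfl⟩ := Nat.exists_eq_add_of_le h.le
            have := hin k j (by omega)
            push_cast
            linarith
          · rw [hfree k m (by omega) hm]
            have h1 := hin k (xi (N k)) le_rfl
            have h2 := hMs (N k + xi (N k))
            have h3 := hlog0 (N k + xi (N k) + 1)
            have h4 : ((N k + xi (N k) + 1 : ℕ) : ℝ) ≤ m := by exact_mod_cast h'
            have h5 := mul_le_mul_of_nonneg_right hσ (sub_nonneg.2 h4)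
            push_cast at h5 ⊢
            linarith
    exact fun m => hind m m (hmono.id_le m)
  · intro a ha
    rw [frequently_atTop]
    intro M
    obtain ⟨k, hk, hka⟩ := frequently_atTop.1 (hef a ha) M
    refine ⟨N k + xi (N k) + 1, by have := hmono.id_le k; simp only [id] at this; omega, ?_⟩
    rw [hDin _ k ⟨by omega, le_rfl⟩]
    have hl := hle (N k)
    simp only [hB, blockChoice]
    rw [if_neg (by omega), if_neg (by omega), hka]
  · have : ∀ k, (∀ j, 1 ≤ j → j ≤ lam (N k) → D (N k + j) = {d₀ j}) ∧
        ∀ j, 1 ≤ j → j ≤ xi (N k) → D (N k + j) ⊆ J2 J (d₀ j).2 := by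
      intro k
      have hl := hle (N k)
      constructor
      · intro j h1 h2
        rw [hDin _ k ⟨by omega, by omega⟩, Nat.add_sub_cancel_left]
        exact if_pos h2
      · intro j h1 h2
        rw [hDin _ k ⟨by omega, by omega⟩, Nat.add_sub_cancel_left]
        simp only [hB, blockChoice]
        split_ifs
        · exact Finset.singleton_subset_iff.2 (mem_J2_self (hd₀ j h1))
        · exact subset_rfl
    exact hmono.tendsto_atTop.frequently (Frequently.of_forall this)

/-- Lower bound for the dimension: it suffices that infinitely often both natural covers of
`hitSet` are inefficient at exponents slightly above `s`. -/
lemma le_dimH_targetSet (hb : 2 ≤ b) {J : Finset (ℕ × ℕ)}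
    (hJ : J ⊆ Finset.range b ×ˢ Finset.range b) (hJne : J.Nonempty) (R : RepMap b J)
    {lam xi : ℕ → ℕ} (hle : ∀ n, lam n ≤ xi n) (hlam : Tendsto lam atTop atTop) {z w : ℝ}
    {d₀ : ℕ → ℕ × ℕ} (hd₀ : ∀ i, 1 ≤ i → d₀ i ∈ J) (hz : val b (fun i => (d₀ i).1) = z)
    (hw : val b (fun i => (d₀ i).2) = w) {G : ℝ}
    (hG : Tendsto (fun n : ℕ => rowSum J (fun i => (d₀ i).2) n / n) atTop (𝓝 G))
    {s : ℝ≥0} (hs : 0 < s) {s' : ℝ} (hs' : s < s')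
    (hF : ∃ᶠ n : ℕ in atTop, s' * Real.log b * (n + lam n) ≤ n * Real.log J.card ∧
      s' * Real.log b * (n + xi n) ≤ n * Real.log J.card + (xi n - lam n) * G) :
    (s : ℝ≥0∞) ≤ dimH (targetSet R lam xi z w) := by
  have hℓ : 0 < Real.log b := Real.log_pos (by exact_mod_cast hb)
  have hs0 : (0 : ℝ) < s := hs
  have hΓ : 0 ≤ Real.log J.card := Real.log_natCast_nonneg _
  set ℓ := Real.log b with hℓd
  set Γ := Real.log J.card with hΓd
  set S := rowSum J (fun i => (d₀ i).2) with hS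
  have hgap : 0 < (s' - s) * ℓ := mul_pos (by linarith) hℓ
  have hs'ℓ : 0 < s' * ℓ := mul_pos (by linarith) hℓ
  have hss : s * ℓ ≤ s' * ℓ := by nlinarith
  have hσ : s * ℓ ≤ Γ := by
    obtain ⟨n, ⟨h1, -⟩, hn⟩ := (hF.and_eventually (eventually_gt_atTop 0)).exists
    have hn' : (0 : ℝ) < n := by exact_mod_cast hn
    have hl : (0 : ℝ) ≤ lam n := Nat.cast_nonneg _
    refine hss.trans (le_of_mul_le_mul_left ?_ hn')
    nlinarith [mul_nonneg hs'ℓ.le hl]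
  obtain ⟨K, hK1, hK⟩ : ∃ K : ℕ, 1 ≤ K ∧ Γ / K ≤ (s' - s) * ℓ := by
    refine ⟨⌈Γ / ((s' - s) * ℓ)⌉₊ + 1, by omega, ?_⟩
    rw [div_le_iff₀ (by positivity), ← div_le_iff₀' hgap]
    push_cast
    linarith [Nat.le_ceil (Γ / ((s' - s) * ℓ))]
  obtain ⟨M, hM⟩ := eventually_atTop.1 (eventually_abs_le_of_tendsto_div hG (half_pos hgap))
  obtain ⟨D, hDne, hDJ, hDm, hDr, hDh⟩ := exists_digit_sets hJne hd₀ hle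
    (mul_nonneg s.coe_nonneg hℓ.le) hσ hK1 (by
      refine (hF.and_eventually (hlam.eventually (eventually_ge_atTop M))).mono ?_
      rintro n ⟨⟨h1, h2⟩, hnM⟩ j hj
      have hS1 := abs_le.1 (hM (lam n) hnM)
      have hS2 := abs_le.1 (hM (max j (lam n)) (hnM.trans (le_max_right _ _)))
      have hjt : (j : ℝ) ≤ (max j (lam n) : ℕ) := by exact_mod_cast le_max_left _ _
      have hlt : (lam n : ℝ) ≤ (max j (lam n) : ℕ) := by exact_mod_cast le_max_right _ _
      have htx : ((max j (lam n) : ℕ) : ℝ) ≤ xi n := by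
        exact_mod_cast max_le hj (hle n)
      rw [← hS, ← hΓd]
      generalize ((max j (lam n) : ℕ) : ℝ) = t at *
      have hn0 : (0 : ℝ) ≤ n := Nat.cast_nonneg n
      have haff : s' * ℓ * (n + t) ≤ n * Γ + (t - lam n) * G := by
        rcases le_total (s' * ℓ) G with h | h
        · nlinarith
        · nlinarith
      have h3 : n * (Γ * (1 - 1 / K)) = n * Γ - n * (Γ / K) := by ring
      have h4 := mul_le_mul_of_nonneg_left hK hn0
      have h5 := mul_le_mul_of_nonneg_left hlt (half_pos hgap).le
      have h6 := mul_le_mul_of_nonneg_left hjt (mul_nonneg s.coe_nonneg hℓ.le)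
      rw [h3]
      nlinarith)
  refine (le_dimH_digit_set hb D hDne (fun i _ => (hDJ i).trans hJ) s hs
    (Real.exp_pos (-(s * ℓ))) fun m => ?_).trans (dimH_mono ?_)
  · have hb0 : (0 : ℝ) < (b : ℝ) ^ m := by positivity
    rw [Real.rpow_def_of_pos hb0, Real.log_pow, ← hℓd, ← Real.exp_add]
    push_cast
    rw [Finset.prod_congr rfl (g := fun i => Real.exp (Real.log (D i).card)) fun i _ =>
      (Real.exp_log (by exact_mod_cast (hDne i).card_pos)).symm, ← Real.exp_sum,
      Real.exp_le_exp]
    have := hDm m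
    linarith
  · rintro _ ⟨d, hd, rfl⟩
    have hdJ : ∀ i, 1 ≤ i → d i ∈ J := fun i hi => hDJ i (hd i hi)
    refine point_mem_targetSet hb hJ R lam xi z w hdJ (fun a ha => ?_) (hDh.mono ?_)
    · refine ((hDr a ha).and_eventually (eventually_ge_atTop 1)).mono fun i hi => ?_
      have := hd i hi.2
      rw [hi.1] at this
      exact Finset.mem_singleton.1 this
    · rintro n ⟨h1, h2⟩
      rw [← hz, ← hw]
      refine ⟨abs_val_sub_le hb (fun i hi => fst_lt_of_mem hJ hdJ _ (by omega))
        (fst_lt_of_mem hJ hd₀) fun i hi hil => ?_,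
        abs_val_sub_le hb (fun i hi => snd_lt_of_mem hJ hdJ _ (by omega))
        (snd_lt_of_mem hJ hd₀) fun i hi hil => ?_⟩
      · have := hd (n + i) (by omega)
        rw [h1 i hi hil, Finset.mem_singleton] at this
        rw [add_comm, this]
      · have := h2 i hi hil (hd (n + i) (by omega))
        rw [add_comm]
        exact (Finset.mem_filter.1 this).2

lemma ratio_fst_eq {n : ℕ} (hn : 0 < n) (Γ ℓ : ℝ) (l : ℕ) :
    Γ / ℓ / (1 + (l : ℝ) / n) = n * Γ / ℓ / (n + l) := by
  have hn' : (0 : ℝ) < n := by exact_mod_cast hn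
  have h1 : (0 : ℝ) < n + l := by positivity
  rw [show 1 + (l : ℝ) / n = (n + l) / n by field_simp]
  field_simp

lemma ratio_snd_eq {n : ℕ} (hn : 0 < n) (Γ ℓ G : ℝ) (l x : ℕ) :
    (Γ / ℓ + ((x : ℝ) - l) / n * (G / ℓ)) / (1 + (x : ℝ) / n) =
      (n * Γ + (x - l) * G) / ℓ / (n + x) := by
  have hn' : (0 : ℝ) < n := by exact_mod_cast hn
  have h1 : (0 : ℝ) < n + x := by positivity
  rw [show 1 + (x : ℝ) / n = (n + x) / n by field_simp]
  field_simp

end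

theorem stmt_18
    (b : ℕ) (J : Finset (ℕ × ℕ)) (hb : 2 ≤ b)
    (hJ : J ⊂ Finset.range b ×ˢ Finset.range b) (hJcard : 2 ≤ J.card)
    (R : RepMap b J) (lam xi : ℕ → ℕ)
    (hlam_pos : ∀ n, 1 ≤ lam n) (hle : ∀ n, lam n ≤ xi n)
    (hlam_top : Tendsto lam atTop atTop)
    (z w : ℝ) (hzw : (z, w) ∈ carpet b J)
    (p : ℕ → ℝ)
    (hp : ∀ a, a < b →
      Tendsto (fun n : ℕ => (freqCount (wdig R (z, w)) a n : ℝ) / n) atTop (𝓝 (p a)))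
    (hp0 : p 0 ≠ 1) (hpb : p (b - 1) ≠ 1) :
    dimH (targetSet R lam xi z w) =
      ENNReal.ofReal (Filter.limsup (fun n : ℕ =>
        min ((Real.log J.card / Real.log b) / (1 + (lam n : ℝ) / n))
          (((Real.log J.card / Real.log b) + (((xi n : ℝ) - (lam n : ℝ)) / n) *
              ((∑ a ∈ Finset.range b, p a * Real.log ((J2 J a).card)) / Real.log b)) /
            (1 + (xi n : ℝ) / n))) atTop) := by
  have hJs := hJ.subset
  have hJne : J.Nonempty := Finset.card_pos.1 (by omega)
  have hd₀ := R.mem_J _ hzw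
  have hzw' := R.eq_val _ hzw
  have hz : val b (fun i => (R.rep (z, w) i).1) = z := (congrArg Prod.fst hzw').symm
  have hw : val b (fun i => (R.rep (z, w) i).2) = w := (congrArg Prod.snd hzw').symm
  have hwb : ∀ i, 1 ≤ i → wdig R (z, w) i < b := snd_lt_of_mem hJs hd₀
  have hG : Tendsto (fun n : ℕ => rowSum J (fun i => (R.rep (z, w) i).2) n / n) atTop
      (𝓝 (∑ a ∈ Finset.range b, p a * Real.log ((J2 J a).card))) :=
    tendsto_rowSum_div J hwb hp
  have hG0 : 0 ≤ ∑ a ∈ Finset.range b, p a * Real.log ((J2 J a).card) :=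
    ge_of_tendsto' hG fun n => div_nonneg
      (Finset.sum_nonneg fun i _ => Real.log_natCast_nonneg _) (Nat.cast_nonneg n)
  have hℓ : 0 < Real.log b := Real.log_pos (by exact_mod_cast hb)
  have hΓ : 0 ≤ Real.log J.card := Real.log_natCast_nonneg _
  generalize (∑ a ∈ Finset.range b, p a * Real.log ((J2 J a).card)) = G at *
  set F : ℕ → ℝ := fun n : ℕ =>
    min ((Real.log J.card / Real.log b) / (1 + (lam n : ℝ) / n))
      (((Real.log J.card / Real.log b) + (((xi n : ℝ) - (lam n : ℝ)) / n) * (G / Real.log b)) /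
        (1 + (xi n : ℝ) / n)) with hF
  have hF0 : ∀ n, 0 ≤ F n := fun n => by
    have : (0 : ℝ) ≤ (xi n : ℝ) - lam n := sub_nonneg.2 (by exact_mod_cast hle n)
    exact le_min (by positivity) (by positivity)
  have hF1 : ∀ n, F n ≤ Real.log J.card / Real.log b := fun n =>
    (min_le_left _ _).trans (div_le_self (by positivity) (le_add_of_nonneg_right (by positivity)))
  have hbdd : IsBoundedUnder (· ≤ ·) atTop F := isBoundedUnder_of ⟨_, hF1⟩
  have hcobdd : IsCoboundedUnder (· ≤ ·) atTop F :=
    IsBoundedUnder.isCoboundedUnder_le (isBoundedUnder_of ⟨0, hF0⟩)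
  have hn0 : ∀ n k : ℕ, 0 < n → (0 : ℝ) < n + k := fun n k hn => by positivity
  refine le_antisymm ?_ ?_
  · refine ENNReal.le_of_forall_pos_le_add fun ε hε _ => ?_
    have hε' : (0 : ℝ) < ε := hε
    have hlt : limsup F atTop < ((limsup F atTop).toNNReal + ε : ℝ≥0) - (ε : ℝ) / 2 := by
      push_cast
      linarith [Real.le_coe_toNNReal (limsup F atTop)]
    refine (dimH_mono (targetSet_subset hb hJs R lam xi z w)).trans
      (dimH_limsup_hitSet_le hb hJs hJcard hle hlam_top hd₀ hz hG (fun δ hδ => ?_)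
        ((limsup F atTop).toNNReal + ε) (half_pos hε') ?_)
    · have h := eventually_digits_eq hb hwb hp hp0 hpb hδ
      rwa [show val b (wdig R (z, w)) = w from hw] at h
    · filter_upwards [eventually_lt_of_limsup_lt hlt hbdd, eventually_gt_atTop 0] with n hn hn1
      rcases min_lt_iff.1 hn with h | h
      · left
        rw [ratio_fst_eq hn1, div_lt_iff₀ (hn0 _ _ hn1), div_lt_iff₀ hℓ] at h
        linarith
      · right
        rw [ratio_snd_eq hn1, div_lt_iff₀ (hn0 _ _ hn1), div_lt_iff₀ hℓ] at h
        linarith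
  · refine ENNReal.le_of_forall_nnreal_lt fun s hs => ?_
    rcases eq_zero_or_pos s with rfl | hs0
    · simp
    rw [ENNReal.lt_ofReal_iff_toReal_lt ENNReal.coe_ne_top, ENNReal.coe_toReal] at hs
    obtain ⟨s', h1, h2⟩ := exists_between hs
    refine le_dimH_targetSet hb hJs hJne R hle hlam_top hd₀ hz hw hG hs0 h1 ?_
    refine ((frequently_lt_of_lt_limsup hcobdd h2).and_eventually (eventually_gt_atTop 0)).mono ?_
    rintro n ⟨hn, hn1⟩
    obtain ⟨h3, h4⟩ := lt_min_iff.1 hn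
    rw [ratio_fst_eq hn1, lt_div_iff₀ (hn0 _ _ hn1), lt_div_iff₀ hℓ] at h3
    rw [ratio_snd_eq hn1, lt_div_iff₀ (hn0 _ _ hn1), lt_div_iff₀ hℓ] at h4
    constructor <;> linarith

end ShrinkingRect
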